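/- arXiv:0810.2207 — 3 statements merged into one kernel-verified Lean document; each statement's English description precedes it below -/
import Mathlib

section
/- Let Q be an LDP-polygon and let F be a facet of Q with l_F = m_Q. Assume there exists a lattice point x ∈ pos(F) := ℝ_{≥0}·F that is not a vertex of Q and satisfies ⟨η_F, x⟩ = 1. Then for every lattice point m ∈ Q ∩ ℤ² with m ∉ F, the point m + x is also a lattice point of Q. -/
open Pointwise

/-- The embedding of the lattice `ℤ²` into `ℚ²`. -/
def toQ (p : ℤ × ℤ) : ℚ × ℚ := ((p.1 : ℚ), (p.2 : ℚ))

/-- The pairing between the dual lattice `ℤ²` and `ℚ²`. -/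
def pairQ (η : ℤ × ℤ) (x : ℚ × ℚ) : ℚ := (η.1 : ℚ) * x.1 + (η.2 : ℚ) * x.2

/-- A lattice polygon: the convex hull of finitely many lattice points,
with nonempty interior. -/
def IsLatticePolygon (Q : Set (ℚ × ℚ)) : Prop :=
  (∃ S : Finset (ℤ × ℤ), Q = convexHull ℚ (toQ '' (S : Set (ℤ × ℤ)))) ∧
    (interior Q).Nonempty

/-- An IP-polygon: a lattice polygon containing the origin in its interior. -/
def IsIPPolygon (Q : Set (ℚ × ℚ)) : Prop :=
  IsLatticePolygon Q ∧ (0 : ℚ × ℚ) ∈ interior Q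

/-- The vertices of a polygon are its extreme points. -/
def vertices (Q : Set (ℚ × ℚ)) : Set (ℚ × ℚ) := Set.extremePoints ℚ Q

/-- An LDP-polygon: an IP-polygon all of whose vertices are primitive lattice points. -/
def IsLDPPolygon (Q : Set (ℚ × ℚ)) : Prop :=
  IsIPPolygon Q ∧ ∀ v ∈ vertices Q, ∃ p : ℤ × ℤ, Int.gcd p.1 p.2 = 1 ∧ v = toQ p

/-- `IsFacetWith Q η l F` : `F` is a facet (edge) of `Q` with primitive outer normal
`η` and local index `l`, i.e. `⟨η, x⟩ = l` on `F` and `⟨η, y⟩ ≤ l` on `Q`. -/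
def IsFacetWith (Q : Set (ℚ × ℚ)) (η : ℤ × ℤ) (l : ℤ) (F : Set (ℚ × ℚ)) : Prop :=
  Int.gcd η.1 η.2 = 1 ∧ 0 < l ∧
  (∀ y ∈ Q, pairQ η y ≤ (l : ℚ)) ∧
  F = {x ∈ Q | pairQ η x = (l : ℚ)} ∧
  ∃ x ∈ F, ∃ y ∈ F, x ≠ y

/-- `F` is a facet of `Q`. -/
def IsFacet (Q F : Set (ℚ × ℚ)) : Prop := ∃ η l, IsFacetWith Q η l F

/-- `HasMaxLocalIndex Q k` : the maximal local index `m_Q` of `Q` equals `k`. -/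
def HasMaxLocalIndex (Q : Set (ℚ × ℚ)) (k : ℤ) : Prop :=
  (∃ F η, IsFacetWith Q η k F) ∧ ∀ F η l, IsFacetWith Q η l F → l ≤ k

/-- `HasIndex Q ℓ` : the index `ℓ_Q` of `Q` (the lcm of all local indices) equals `ℓ`. -/
def HasIndex (Q : Set (ℚ × ℚ)) (ℓ : ℤ) : Prop :=
  0 < ℓ ∧ (∀ F η l, IsFacetWith Q η l F → l ∣ ℓ) ∧
  ∀ m : ℤ, 0 < m → (∀ F η l, IsFacetWith Q η l F → l ∣ m) → ℓ ∣ m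

/-- The only lattice point in the interior of `(1/k)·Q` is the origin. -/
def NoIntLatticePts (Q : Set (ℚ × ℚ)) (k : ℤ) : Prop :=
  ∀ p : ℤ × ℤ, toQ p ∈ interior (((k : ℚ)⁻¹) • Q) → p = 0

/-- `HasOrder Q I` : the order `o_Q` of `Q` equals `I`. -/
def HasOrder (Q : Set (ℚ × ℚ)) (I : ℤ) : Prop :=
  1 ≤ I ∧ NoIntLatticePts Q I ∧ ∀ k : ℤ, 1 ≤ k → NoIntLatticePts Q k → I ≤ k

/-- The cone `pos(F) = ℝ≥0·F` spanned by `F` (inside `ℚ²`). -/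
def posCone (F : Set (ℚ × ℚ)) : Set (ℚ × ℚ) :=
  {y | ∃ t : ℚ, 0 ≤ t ∧ ∃ z ∈ F, y = t • z}

/-- The number of lattice points in a subset of `ℚ²`. -/
noncomputable def latticeCount (S : Set (ℚ × ℚ)) : ℕ :=
  {p : ℤ × ℤ | toQ p ∈ S}.ncard

/-- The normalised volume of `Q`: twice the Euclidean area of the corresponding
real region. -/
noncomputable def nVol (Q : Set (ℚ × ℚ)) : ℝ :=
  2 * (MeasureTheory.volume
    (closure ((fun x : ℚ × ℚ => ((x.1 : ℝ), (x.2 : ℝ))) '' Q))).toReal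

/-- Unimodular equivalence: `Q'` is the image of `Q` under an element of `GL(2,ℤ)`. -/
def UnimodEquiv (Q Q' : Set (ℚ × ℚ)) : Prop :=
  ∃ a b c d : ℤ, (a * d - b * c = 1 ∨ a * d - b * c = -1) ∧
    (fun x : ℚ × ℚ => ((a : ℚ) * x.1 + (b : ℚ) * x.2,
      (c : ℚ) * x.1 + (d : ℚ) * x.2)) '' Q = Q'

lemma hull_le (S : Finset (ℤ × ℤ)) (a b M : ℚ)
    (h : ∀ s ∈ S, a * (s.1 : ℚ) + b * (s.2 : ℚ) ≤ M) :
    ∀ y ∈ convexHull ℚ (toQ '' (S : Set (ℤ × ℤ))), a * y.1 + b * y.2 ≤ M := by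
  have hc : Convex ℚ {y : ℚ × ℚ | a * y.1 + b * y.2 ≤ M} := by
    apply convex_halfSpace_le
    constructor
    · intro x y; simp only [Prod.fst_add, Prod.snd_add]; ring
    · intro c x; simp only [Prod.smul_fst, Prod.smul_snd, smul_eq_mul]; ring
  intro y hy
  refine convexHull_min ?_ hc hy
  rintro _ ⟨s, hs, rfl⟩
  exact h s hs

lemma interior_scale {Q : Set (ℚ × ℚ)} (h0 : (0 : ℚ × ℚ) ∈ interior Q) (v : ℚ × ℚ) :
    ∃ ε : ℚ, 0 < ε ∧ ε • v ∈ Q := by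
  have hcont : Continuous (fun t : ℚ => ((t * v.1, t * v.2) : ℚ × ℚ)) := by fun_prop
  have h1 : Q ∈ nhds ((fun t : ℚ => ((t * v.1, t * v.2) : ℚ × ℚ)) 0) := by
    simp only [zero_mul]
    exact mem_interior_iff_mem_nhds.mp h0
  have h2 := hcont.continuousAt.preimage_mem_nhds h1
  obtain ⟨ε, hε, hb⟩ := (nhds_basis_abs_sub_lt (0 : ℚ)).mem_iff.mp h2
  refine ⟨ε / 2, by positivity, ?_⟩
  have : ε / 2 ∈ {b : ℚ | |b - 0| < ε} := by
    simp only [sub_zero, Set.mem_ofPred_eq]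
    rw [abs_of_pos (by positivity)]
    linarith
  exact hb this

lemma exists_primitive (a b : ℚ) (h : a ≠ 0 ∨ b ≠ 0) :
    ∃ (η : ℤ × ℤ) (c : ℚ), 0 < c ∧ Int.gcd η.1 η.2 = 1 ∧ (η.1 : ℚ) = c * a ∧
      (η.2 : ℚ) = c * b := by
  have ha : (a.den : ℚ) ≠ 0 := by exact_mod_cast a.den_nz
  have hb : (b.den : ℚ) ≠ 0 := by exact_mod_cast b.den_nz
  have ha' : (0 : ℚ) < a.den := by exact_mod_cast a.den_pos
  have hb' : (0 : ℚ) < b.den := by exact_mod_cast b.den_pos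
  have ea : a * a.den = a.num := Rat.mul_den_eq_num a
  have eb : b * b.den = b.num := Rat.mul_den_eq_num b
  set A : ℤ := a.num * b.den with hA
  set B : ℤ := b.num * a.den with hB
  have eA : (A : ℚ) = (a.den * b.den) * a := by
    rw [hA]; push_cast; rw [← ea]; ring
  have eB : (B : ℚ) = (a.den * b.den) * b := by
    rw [hB]; push_cast; rw [← eb]; ring
  have hg : 0 < Int.gcd A B := by
    rw [Int.gcd_pos_iff]
    rcases h with h | h
    · left; intro h0
      rw [h0] at eA
      have : (a.den * b.den : ℚ) * a ≠ 0 := by positivity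
      exact this (by rw [← eA]; simp)
    · right; intro h0
      rw [h0] at eB
      have : (a.den * b.den : ℚ) * b ≠ 0 := by positivity
      exact this (by rw [← eB]; simp)
  obtain ⟨A', B', hcop, h1, h2⟩ := Int.exists_gcd_one hg
  have hgq : (0 : ℚ) < (Int.gcd A B : ℕ) := by exact_mod_cast hg
  have h1q : (A : ℚ) = A' * (Int.gcd A B : ℕ) := by exact_mod_cast congrArg (Int.cast : ℤ → ℚ) h1
  have h2q : (B : ℚ) = B' * (Int.gcd A B : ℕ) := by exact_mod_cast congrArg (Int.cast : ℤ → ℚ) h2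
  refine ⟨(A', B'), (a.den * b.den) / (Int.gcd A B : ℕ), by positivity, hcop, ?_, ?_⟩
  · simp only
    rw [div_mul_eq_mul_div, ← eA, h1q]; field_simp
  · simp only
    rw [div_mul_eq_mul_div, ← eB, h2q]; field_simp

/-- A point outside the polygon is separated from it by a facet. -/
lemma exists_facet_sep (Q : Set (ℚ × ℚ)) (hQ : IsIPPolygon Q) (p : ℚ × ℚ) (hp : p ∉ Q) :
    ∃ (G : Set (ℚ × ℚ)) (η : ℤ × ℤ) (l : ℤ), IsFacetWith Q η l G ∧ (l : ℚ) < pairQ η p := by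
  obtain ⟨⟨⟨S, hS⟩, -⟩, h0⟩ := hQ
  have hconv : Convex ℚ Q := by rw [hS]; exact convex_convexHull _ _
  have h0Q : (0 : ℚ × ℚ) ∈ Q := interior_subset h0
  have hSQ : ∀ s ∈ S, toQ s ∈ Q := by
    intro s hs; rw [hS]; exact subset_convexHull _ _ ⟨s, hs, rfl⟩
  have hN : 0 < p.1 * p.1 + p.2 * p.2 := by
    by_contra hcon
    have h1 : p.1 = 0 := by nlinarith [mul_self_nonneg p.1, mul_self_nonneg p.2]
    have h2 : p.2 = 0 := by nlinarith [mul_self_nonneg p.1, mul_self_nonneg p.2]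
    exact hp (by rwa [show p = 0 from Prod.ext h1 h2])
  let C : ℚ × ℚ → ℚ := fun r => p.1 * r.1 + p.2 * r.2
  let D : ℚ × ℚ → ℚ := fun r => p.2 * r.1 - p.1 * r.2
  have key : ∀ a b M : ℚ, (∀ s ∈ S, a * (s.1 : ℚ) + b * (s.2 : ℚ) ≤ M) →
      ∀ y ∈ Q, a * y.1 + b * y.2 ≤ M := by
    intro a b M h y hy; rw [hS] at hy; exact hull_le S a b M h y hy
  -- points on both sides
  have hpos : ∃ s ∈ S, 0 < D (toQ s) := by
    by_contra! hcon
    have := key p.2 (-p.1) 0 (by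
      intro s hs; have := hcon s hs; simp only [D, toQ] at this; linarith)
    obtain ⟨ε, hε, hy⟩ := interior_scale h0 (p.2, -p.1)
    have := this _ hy
    simp only [Prod.smul_mk, smul_eq_mul] at this
    nlinarith [mul_pos hε hN]
  have hneg : ∃ s ∈ S, D (toQ s) ≤ 0 := by
    by_contra! hcon
    have := key (-p.2) (p.1) 0 (by
      intro s hs; have := hcon s hs; simp only [D, toQ] at this; linarith)
    obtain ⟨ε, hε, hy⟩ := interior_scale h0 (-p.2, p.1)
    have := this _ hy
    simp only [Prod.smul_mk, smul_eq_mul] at this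
    nlinarith [mul_pos hε hN]
  let P := S.filter (fun s => 0 < D (toQ s))
  let N := S.filter (fun s => D (toQ s) ≤ 0)
  have hPne : P.Nonempty := by
    obtain ⟨s, hs, h⟩ := hpos; exact ⟨s, Finset.mem_filter.mpr ⟨hs, h⟩⟩
  have hNne : N.Nonempty := by
    obtain ⟨s, hs, h⟩ := hneg; exact ⟨s, Finset.mem_filter.mpr ⟨hs, h⟩⟩
  let W : (ℤ × ℤ) × (ℤ × ℤ) → ℚ := fun q =>
    (D (toQ q.1) * C (toQ q.2) - D (toQ q.2) * C (toQ q.1)) / (D (toQ q.1) - D (toQ q.2))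
  obtain ⟨⟨s, s'⟩, hss, hmaxW⟩ := (P ×ˢ N).exists_max_image W (hPne.product hNne)
  obtain ⟨hsP, hsN⟩ := Finset.mem_product.mp hss
  obtain ⟨hsS, hsD⟩ := Finset.mem_filter.mp hsP
  obtain ⟨hsS', hsD'⟩ := Finset.mem_filter.mp hsN
  simp only at hsS hsD hsS' hsD'
  obtain ⟨M, hM⟩ : ∃ M, M = W (s, s') := ⟨_, rfl⟩
  rw [← hM] at hmaxW
  obtain ⟨r, hrP, hminr⟩ := P.exists_min_image (fun r => (M - C (toQ r)) / D (toQ r)) hPne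
  obtain ⟨hrS, hrD⟩ := Finset.mem_filter.mp hrP
  obtain ⟨lam, hlam⟩ : ∃ lam, lam = (M - C (toQ r)) / D (toQ r) := ⟨_, rfl⟩
  have hru : C (toQ r) + lam * D (toQ r) = M := by
    rw [hlam]; field_simp; ring
  have hle : ∀ y ∈ S, C (toQ y) + lam * D (toQ y) ≤ M := by
    intro y hy
    by_cases hyD : 0 < D (toQ y)
    · have := hminr y (Finset.mem_filter.mpr ⟨hy, hyD⟩)
      rw [← hlam, le_div_iff₀ hyD] at this
      linarith
    · push Not at hyD
      have := hmaxW (r, y) (Finset.mem_product.mpr ⟨hrP, Finset.mem_filter.mpr ⟨hy, hyD⟩⟩)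
      simp only [W] at this
      rw [div_le_iff₀ (by linarith)] at this
      have h3 : D (toQ r) * (C (toQ y) + lam * D (toQ y)) ≤ D (toQ r) * M := by
        have : lam * D (toQ r) = M - C (toQ r) := by linarith
        have h4 : D (toQ r) * (C (toQ y) + lam * D (toQ y)) =
          D (toQ r) * C (toQ y) + (lam * D (toQ r)) * D (toQ y) := by ring
        rw [h4, this]; linarith
      exact le_of_mul_le_mul_left h3 hrD
  have hua : ∀ y : ℚ × ℚ, (p.1 + lam * p.2) * y.1 + (p.2 - lam * p.1) * y.2
      = C y + lam * D y := by intro y; simp only [C, D]; ring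
  have hleQ : ∀ y ∈ Q, C y + lam * D y ≤ M := by
    intro y hy
    rw [← hua]
    refine key _ _ _ ?_ y hy
    intro s hs
    have := hle s hs
    rw [← hua] at this
    exact this
  have hMpos : 0 < M := by
    obtain ⟨ε, hε, hy⟩ := interior_scale h0 p
    have := hleQ _ hy
    simp only [C, D, Prod.smul_fst, Prod.smul_snd, smul_eq_mul] at this
    nlinarith [mul_pos hε hN]
  -- crossing point
  have hden : 0 < D (toQ s) - D (toQ s') := by linarith
  obtain ⟨w, hw⟩ : ∃ w : ℚ × ℚ, w = (-D (toQ s') / (D (toQ s) - D (toQ s'))) • toQ s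
    + (D (toQ s) / (D (toQ s) - D (toQ s'))) • toQ s' := ⟨_, rfl⟩
  have hwQ : w ∈ Q := by
    rw [hw]
    apply hconv (hSQ s hsS) (hSQ s' hsS')
    · exact div_nonneg (by linarith) hden.le
    · exact div_nonneg hsD.le hden.le
    · field_simp; ring
  have hlinC : ∀ (a b : ℚ) (y z : ℚ × ℚ), C (a • y + b • z) = a * C y + b * C z := by
    intro a b y z
    simp only [C, Prod.fst_add, Prod.snd_add, Prod.smul_fst, Prod.smul_snd, smul_eq_mul]; ring
  have hlinD : ∀ (a b : ℚ) (y z : ℚ × ℚ), D (a • y + b • z) = a * D y + b * D z := by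
    intro a b y z
    simp only [D, Prod.fst_add, Prod.snd_add, Prod.smul_fst, Prod.smul_snd, smul_eq_mul]; ring
  have hwD : D w = 0 := by rw [hw, hlinD]; field_simp; ring
  have hwC : C w = M := by rw [hw, hlinC, hM]; simp only [W]; field_simp; ring
  have hpM : M < C p := by
    by_contra! hcon
    apply hp
    have hCp : C p = p.1 * p.1 + p.2 * p.2 := rfl
    have h1 : (C p / M) • w ∈ Q := by
      have := hconv h0Q hwQ (a := 1 - C p / M) (b := C p / M)
        (by rw [sub_nonneg, div_le_one hMpos]; exact hcon)
        (div_nonneg (by rw [hCp]; exact hN.le) hMpos.le) (by ring)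
      simpa using this
    have h2 : (C p / M) • w = p := by
      have e1 : C p * w.1 = M * p.1 := by
        rw [← hwC]
        have : D w * p.2 = 0 := by rw [hwD]; ring
        simp only [C, D] at this ⊢; linarith
      have e2 : C p * w.2 = M * p.2 := by
        rw [← hwC]
        have : D w * p.1 = 0 := by rw [hwD]; ring
        simp only [C, D] at this ⊢; linarith
      ext
      · simp only [Prod.smul_fst, smul_eq_mul]; rw [div_mul_eq_mul_div, e1]; field_simp
      · simp only [Prod.smul_snd, smul_eq_mul]; rw [div_mul_eq_mul_div, e2]; field_simp
    rwa [h2] at h1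
  have hne : p.1 + lam * p.2 ≠ 0 ∨ p.2 - lam * p.1 ≠ 0 := by
    by_contra! hcon
    have := hua (toQ r)
    rw [hcon.1, hcon.2, hru] at this
    linarith
  obtain ⟨η, c, hc, hgcd, e1, e2⟩ := exists_primitive _ _ hne
  have hpair : ∀ y, pairQ η y = c * (C y + lam * D y) := by
    intro y; rw [← hua, pairQ, e1, e2]; ring
  let l : ℤ := η.1 * r.1 + η.2 * r.2
  have hl : (l : ℚ) = c * M := by
    rw [← hru, ← hpair]; simp only [l, pairQ, toQ]; push_cast; ring
  refine ⟨{y ∈ Q | pairQ η y = (l : ℚ)}, η, l, ⟨hgcd, ?_, ?_, rfl, ?_⟩, ?_⟩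
  · have : (0 : ℚ) < l := by rw [hl]; positivity
    exact_mod_cast this
  · intro y hy; rw [hl, hpair]; exact mul_le_mul_of_nonneg_left (hleQ y hy) hc.le
  · refine ⟨toQ r, ⟨hSQ r hrS, ?_⟩, w, ⟨hwQ, ?_⟩, ?_⟩
    · rw [hpair, hru, hl]
    · rw [hpair, hwD, hwC, hl]; ring
    · intro h; rw [h, hwD] at hrD; exact lt_irrefl _ hrD
  · rw [hl, hpair]
    have : D p = 0 := by simp only [D]; ring
    rw [this]
    simpa using mul_lt_mul_of_pos_left hpM hc

/-- Projection lemma: if `F` is a facet of an LDP-polygon `Q` of maximal local index,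
and `x` is a non-vertex lattice point in `pos(F)` with `⟨η_F, x⟩ = 1`, then for every
lattice point `m` of `Q` not lying on `F`, the point `m + x` also lies in `Q`. -/
theorem projection_lemma
    (Q : Set (ℚ × ℚ)) (F : Set (ℚ × ℚ)) (η : ℤ × ℤ) (k : ℤ)
    (hQ : IsLDPPolygon Q) (hF : IsFacetWith Q η k F) (hmax : HasMaxLocalIndex Q k)
    (x : ℤ × ℤ) (hxpos : toQ x ∈ posCone F) (hxnv : toQ x ∉ vertices Q)
    (hx1 : pairQ η (toQ x) = 1)
    (m : ℤ × ℤ) (hm : toQ m ∈ Q) (hmF : toQ m ∉ F) :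
    toQ (m + x) ∈ Q := by
  by_contra hnot
  obtain ⟨G, η', l, hG, hlt⟩ := exists_facet_sep Q hQ.1 _ hnot
  have hlk : l ≤ k := hmax.2 _ _ _ hG
  obtain ⟨-, hl0, hGle, -, -⟩ := hG
  obtain ⟨-, hk0, hFle, hFeq, -⟩ := hF
  have hkq : (0 : ℚ) < k := by exact_mod_cast hk0
  obtain ⟨t, ht, z, hz, hxz⟩ := hxpos
  rw [hFeq] at hz
  obtain ⟨hzQ, hzk⟩ := hz
  have hsm : ∀ (e : ℤ × ℤ) (c : ℚ) (y : ℚ × ℚ), pairQ e (c • y) = c * pairQ e y := by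
    intro e c y; simp only [pairQ, Prod.smul_fst, Prod.smul_snd, smul_eq_mul]; ring
  have htk : t * k = 1 := by rw [← hx1, hxz, hsm, hzk]
  have hzx : z = (k : ℚ) • toQ x := by
    rw [hxz, smul_smul, mul_comm, htk, one_smul]
  have hint : ∀ e y : ℤ × ℤ, pairQ e (toQ y) = ((e.1 * y.1 + e.2 * y.2 : ℤ) : ℚ) := by
    intro e y; simp only [pairQ, toQ]; push_cast; ring
  have hadd : pairQ η' (toQ (m + x)) = pairQ η' (toQ m) + pairQ η' (toQ x) := by
    simp only [pairQ, toQ, Prod.fst_add, Prod.snd_add]; push_cast; ring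
  have hmle := hGle _ hm
  have hzle := hGle _ hzQ
  rw [hzx, hsm] at hzle
  have hpos : 0 < pairQ η' (toQ x) := by linarith
  have hge : 1 ≤ pairQ η' (toQ x) := by
    rw [hint] at hpos ⊢; norm_cast at hpos ⊢
  have hlkq : (l : ℚ) ≤ k := by exact_mod_cast hlk
  have hx1' : pairQ η' (toQ x) = 1 := by nlinarith
  have hlk' : (l : ℚ) = k := by rw [hx1'] at hzle; linarith
  by_cases hdet : η.1 * η'.2 - η.2 * η'.1 = 0
  · -- the two normals agree
    have i1 := hx1
    have i2 := hx1'
    rw [hint] at i1 i2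
    norm_cast at i1 i2
    have e1 : η'.1 = η.1 := by
      linear_combination (-η'.1) * i1 + η.1 * i2 - x.2 * hdet
    have e2 : η'.2 = η.2 := by
      linear_combination (-η'.2) * i1 + η.2 * i2 + x.1 * hdet
    have ee : η' = η := Prod.ext e1 e2
    rw [ee] at hlt hadd
    have hlt2 : pairQ η (toQ m) < k := by
      refine lt_of_le_of_ne (hFle _ hm) ?_
      intro h; apply hmF; rw [hFeq]; exact ⟨hm, h⟩
    rw [hadd, hx1, hlk', hint] at hlt
    rw [hint] at hlt2
    norm_cast at hlt hlt2
    omega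
  · have hdetq : (η.1 : ℚ) * η'.2 - η.2 * η'.1 ≠ 0 := by exact_mod_cast hdet
    have hz' : pairQ η' z = k := by rw [hzx, hsm, hx1', mul_one]
    have huniq : ∀ y : ℚ × ℚ, pairQ η y = k → pairQ η' y = k → y = z := by
      intro y h1 h2
      rw [← hzk] at h1
      rw [← hz'] at h2
      simp only [pairQ] at h1 h2
      ext
      · apply mul_left_cancel₀ hdetq
        linear_combination (η'.2 : ℚ) * h1 - (η.2 : ℚ) * h2
      · apply mul_left_cancel₀ hdetq
        linear_combination (-(η'.1 : ℚ)) * h1 + (η.1 : ℚ) * h2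
    have hzv : z ∈ vertices Q := by
      rw [vertices, mem_extremePoints]
      refine ⟨hzQ, ?_⟩
      rintro y1 hy1 y2 hy2 ⟨a, b, ha, hb, hab, hyz⟩
      have hcomb : ∀ e : ℤ × ℤ, pairQ e z = a * pairQ e y1 + b * pairQ e y2 := by
        intro e; rw [← hyz]
        simp only [pairQ, Prod.fst_add, Prod.snd_add, Prod.smul_fst, Prod.smul_snd, smul_eq_mul]
        ring
      have hext : ∀ e : ℤ × ℤ, pairQ e z = k → pairQ e y1 ≤ k → pairQ e y2 ≤ k →
          pairQ e y1 = k ∧ pairQ e y2 = k := by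
        intro e h h1 h2
        rw [hcomb e] at h
        have hb' : b = 1 - a := by linarith
        constructor
        · refine le_antisymm h1 ?_
          by_contra! hc
          nlinarith [mul_pos ha (sub_pos.mpr hc), mul_nonneg hb.le (sub_nonneg.mpr h2)]
        · refine le_antisymm h2 ?_
          by_contra! hc
          nlinarith [mul_pos hb (sub_pos.mpr hc), mul_nonneg ha.le (sub_nonneg.mpr h1)]
      have r1 := hext η hzk (hFle _ hy1) (hFle _ hy2)
      have r2 := hext η' hz' (by rw [← hlk']; exact hGle _ hy1) (by rw [← hlk']; exact hGle _ hy2)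
      exact ⟨huniq _ r1.1 r2.1, huniq _ r1.2 r2.2⟩
    obtain ⟨q, hq, hzq⟩ := hQ.2 z hzv
    have hk1 : k = 1 := by
      rw [hzx] at hzq
      have q1 : k * x.1 = q.1 := by
        have := congrArg Prod.fst hzq
        simp only [toQ, Prod.smul_fst, smul_eq_mul] at this
        exact_mod_cast this
      have q2 : k * x.2 = q.2 := by
        have := congrArg Prod.snd hzq
        simp only [toQ, Prod.smul_snd, smul_eq_mul] at this
        exact_mod_cast this
      have hd : k ∣ (Int.gcd q.1 q.2 : ℤ) :=
        Int.dvd_coe_gcd (Dvd.intro _ q1) (Dvd.intro _ q2)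
      rw [hq] at hd
      exact Int.eq_one_of_dvd_one hk0.le (by simpa using hd)
    apply hxnv
    rw [hk1, Int.cast_one, one_smul] at hzx
    rw [← hzx]; exact hzv
end

section
/- Let Q be an LDP-polygon with maximal local index m_Q = k ≥ 2, and suppose F is a facet of Q with local index l_F = k. Then the number of lattice points on F satisfies |F ∩ ℤ²| ≤ 2k². -/
open Pointwise

/-- integer pairing -/
def pairZ (η p : ℤ × ℤ) : ℤ := η.1 * p.1 + η.2 * p.2

theorem pairQ_toQ (η p : ℤ × ℤ) : pairQ η (toQ p) = (pairZ η p : ℚ) := by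
  simp [pairQ, toQ, pairZ]

theorem toQ_inj {p q : ℤ × ℤ} (h : toQ p = toQ q) : p = q := by
  simp only [toQ, Prod.mk.injEq, Int.cast_inj] at h
  exact Prod.ext h.1 h.2

theorem pairQ_le_of_hull (S : Finset (ℤ × ℤ)) (η : ℤ × ℤ) (r : ℤ)
    (h : ∀ s ∈ S, pairZ η s ≤ r) :
    ∀ x ∈ convexHull ℚ (toQ '' (S : Set (ℤ × ℤ))), pairQ η x ≤ (r : ℚ) := by
  have hc : Convex ℚ {x : ℚ × ℚ | pairQ η x ≤ (r : ℚ)} := by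
    intro x hx y hy a b ha hb hab
    simp only [Set.mem_setOf_eq, pairQ, Prod.fst_add, Prod.snd_add, Prod.smul_fst,
      Prod.smul_snd, smul_eq_mul] at *
    have h1 := mul_le_mul_of_nonneg_left hx ha
    have h2 := mul_le_mul_of_nonneg_left hy hb
    have h3 : a * (r : ℚ) + b * r = r := by rw [← add_mul, hab, one_mul]
    linarith
  intro x hx
  refine convexHull_min ?_ hc hx
  rintro _ ⟨s, hs, rfl⟩
  simp only [Set.mem_setOf_eq, pairQ_toQ]
  exact_mod_cast h s hs

theorem exists_pos_of_interior (Q : Set (ℚ × ℚ)) (h0 : (0 : ℚ × ℚ) ∈ interior Q)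
    (η : ℤ × ℤ) (hη : Int.gcd η.1 η.2 = 1) : ∃ q ∈ Q, 0 < pairQ η q := by
  have hcont : Continuous (fun t : ℚ => ((t * (η.1 : ℚ), t * (η.2 : ℚ)) : ℚ × ℚ)) := by
    fun_prop
  have h1 : ∀ᶠ t in nhds (0 : ℚ), ((t * (η.1 : ℚ), t * (η.2 : ℚ)) : ℚ × ℚ) ∈ interior Q := by
    have := hcont.tendsto 0
    apply this.eventually
    simp only [zero_mul]
    exact isOpen_interior.mem_nhds h0
  have h2 : ∀ᶠ t in nhdsWithin (0 : ℚ) (Set.Ioi 0),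
      ((t * (η.1 : ℚ), t * (η.2 : ℚ)) : ℚ × ℚ) ∈ interior Q := h1.filter_mono nhdsWithin_le_nhds
  obtain ⟨t, ht, htpos⟩ := (h2.and self_mem_nhdsWithin).exists
  refine ⟨_, interior_subset ht, ?_⟩
  have htpos : 0 < t := htpos
  have hne : 0 < η.1 ^ 2 + η.2 ^ 2 := by
    rcases eq_or_ne η.1 0 with h | h
    · rcases eq_or_ne η.2 0 with h' | h'
      · simp [h, h'] at hη
      · positivity
    · positivity
  have hne' : (0 : ℚ) < (η.1 : ℚ) ^ 2 + (η.2 : ℚ) ^ 2 := by exact_mod_cast hne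
  have := mul_pos htpos hne'
  simp only [pairQ]
  linarith

theorem exists_vertex_pos (S : Finset (ℤ × ℤ))
    (h0 : (0 : ℚ × ℚ) ∈ interior (convexHull ℚ (toQ '' (S : Set (ℤ × ℤ)))))
    (η : ℤ × ℤ) (hη : Int.gcd η.1 η.2 = 1) : ∃ s ∈ S, 0 < pairZ η s := by
  by_contra! hcon
  obtain ⟨q, hq, hpos⟩ := exists_pos_of_interior _ h0 η hη
  have := pairQ_le_of_hull S η 0 hcon q hq
  push_cast at this
  linarith

/-- The bound coming from the facet adjacent to `F` on one side. -/
theorem side_bound (S : Finset (ℤ × ℤ)) (Q : Set (ℚ × ℚ))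
    (hQS : Q = convexHull ℚ (toQ '' (S : Set (ℤ × ℤ))))
    (h0 : (0 : ℚ × ℚ) ∈ interior Q)
    (hprim : ∀ v ∈ vertices Q, ∃ p : ℤ × ℤ, Int.gcd p.1 p.2 = 1 ∧ v = toQ p)
    (k : ℤ) (hk : 2 ≤ k) (hmax : ∀ F η l, IsFacetWith Q η l F → l ≤ k)
    (η ξ : ℤ × ℤ) (D : ℤ) (hD : D * D = 1) (hdet : ξ.1 * η.2 - ξ.2 * η.1 = D)
    (hη : Int.gcd η.1 η.2 = 1)
    (hle : ∀ y ∈ Q, pairQ η y ≤ (k : ℚ)) (hex : ∃ x ∈ Q, pairQ η x = (k : ℚ)) :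
    ∃ b : ℤ, (∀ p, toQ p ∈ Q → pairZ η p = k → pairZ ξ p ≤ b) ∧
      (∀ p, toQ p ∈ Q → 
        (- pairZ η p) * b + k * pairZ ξ p ≤ (k - 1) * (- pairZ η p + k) ∨ 0 ≤ pairZ η p) := by
  have hSQ : ∀ s ∈ S, toQ s ∈ Q := fun s hs => by
    rw [hQS]; exact subset_convexHull ℚ _ ⟨s, hs, rfl⟩
  have hSle : ∀ s ∈ S, pairZ η s ≤ k := fun s hs => by
    have := hle _ (hSQ s hs)
    rw [pairQ_toQ] at this
    exact_mod_cast this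
  have hne : (S.filter (fun s => pairZ η s = k)).Nonempty := by
    by_contra hcon
    rw [Finset.not_nonempty_iff_eq_empty, Finset.filter_eq_empty_iff] at hcon
    obtain ⟨x, hx, hxk⟩ := hex
    have := pairQ_le_of_hull S η (k - 1) (fun s hs => by
      have h1 := hSle s hs
      have h2 := hcon hs
      omega) x (hQS ▸ hx)
    push_cast at this
    linarith
  obtain ⟨w, hw, hwmax⟩ := Finset.exists_max_image _ (fun s => pairZ ξ s) hne
  simp only [Finset.mem_filter] at hw hwmax
  obtain ⟨hwS, hwk⟩ := hw
  have hne2 : (S.filter (fun s => pairZ η s < k)).Nonempty := by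
    obtain ⟨s, hs, hpos⟩ := exists_vertex_pos S (hQS ▸ h0) (-η.1, -η.2) (by simpa using hη)
    refine ⟨s, Finset.mem_filter.2 ⟨hs, ?_⟩⟩
    simp only [pairZ] at *
    linarith
  obtain ⟨s, hs, hsmin⟩ := Finset.exists_min_image _
    (fun s => ((pairZ ξ w - pairZ ξ s : ℤ) : ℚ) / ((k - pairZ η s : ℤ) : ℚ)) hne2
  simp only [Finset.mem_filter] at hs hsmin
  obtain ⟨hsS, hsk⟩ := hs
  set b := pairZ ξ w with hb
  obtain ⟨A, hA⟩ : ∃ A, A = b - pairZ ξ s := ⟨_, rfl⟩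
  obtain ⟨B, hB⟩ : ∃ B, B = k - pairZ η s := ⟨_, rfl⟩
  have hBpos : 0 < B := by omega
  have hkey : ∀ q ∈ S, A * (k - pairZ η q) ≤ (b - pairZ ξ q) * B := by
    intro q hq
    rcases (hSle q hq).lt_or_eq with h | h
    · have h1 := hsmin q ⟨hq, h⟩
      rw [← hA, ← hB, div_le_div_iff₀ (by exact_mod_cast hBpos) (by
        have : 0 < k - pairZ η q := by omega
        exact_mod_cast this)] at h1
      exact_mod_cast h1
    · have h1 := hwmax q ⟨hq, h⟩
      rw [h, sub_self, mul_zero]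
      exact mul_nonneg (by omega) hBpos.le
  -- primitive normal
  obtain ⟨g, c, d, hg, hcB, hdA, hcop⟩ : ∃ g c d : ℤ, 0 < g ∧ B = g * c ∧ -A = g * d ∧
      IsCoprime c d := by
    have hgpos : 0 < Int.gcd B (-A) := Int.gcd_pos_of_ne_zero_left _ hBpos.ne'
    refine ⟨Int.gcd B (-A), B / Int.gcd B (-A), -A / Int.gcd B (-A), by exact_mod_cast hgpos,
      (Int.mul_ediv_cancel' (Int.gcd_dvd_left _ _)).symm,
      (Int.mul_ediv_cancel' (Int.gcd_dvd_right _ _)).symm, ?_⟩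
    rw [Int.isCoprime_iff_gcd_eq_one]
    exact Int.gcd_ediv_gcd_ediv_gcd hgpos
  have hc : 0 < c := by
    by_contra! h
    nlinarith
  obtain ⟨l, hl⟩ : ∃ l, l = c * b + d * k := ⟨_, rfl⟩
  obtain ⟨θ, hθ⟩ : ∃ θ : ℤ × ℤ, θ = (c * ξ.1 + d * η.1, c * ξ.2 + d * η.2) := ⟨_, rfl⟩
  have hθp : ∀ p, pairZ θ p = c * pairZ ξ p + d * pairZ η p := by
    intro p; simp only [hθ, pairZ]; ring
  have hθQ : ∀ x, pairQ θ x = c * pairQ ξ x + d * pairQ η x := by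
    intro p; simp only [hθ, pairQ]; push_cast; ring
  have hθS : ∀ q ∈ S, pairZ θ q ≤ l := by
    intro q hq
    rw [hθp, hl]
    have h1 := hkey q hq
    have hA' : A = - (g * d) := by omega
    rw [hcB, hA'] at h1
    refine le_of_mul_le_mul_left ?_ hg
    linarith
  have hQθ : ∀ x ∈ Q, pairQ θ x ≤ (l : ℚ) := by
    rw [hQS]; exact pairQ_le_of_hull S θ l hθS
  have hθgcd : Int.gcd θ.1 θ.2 = 1 := by
    rw [← Int.isCoprime_iff_gcd_eq_one]
    obtain ⟨m, n, hmn⟩ := hcop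
    refine ⟨D * (m * η.2 - n * ξ.2), D * (- m * η.1 + n * ξ.1), ?_⟩
    rw [hθ]
    calc _ = D * (ξ.1 * η.2 - ξ.2 * η.1) * (m * c + n * d) := by ring
      _ = 1 := by rw [hdet, hD, hmn, one_mul]
  have hlpos : 0 < l := by
    obtain ⟨q, hq, hpos⟩ := exists_vertex_pos S (hQS ▸ h0) θ hθgcd
    exact hpos.trans_le (hθS q hq)
  have hθw : pairZ θ w = l := by rw [hθp, hl, hwk]
  have hθs : pairZ θ s = l := by
    rw [hθp, hl]
    have e1 : pairZ ξ s = b - A := by omega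
    have e2 : pairZ η s = k - B := by omega
    have hA' : A = - (g * d) := by omega
    rw [e1, e2, hcB, hA']; ring
  have hlk : l ≤ k := by
    refine hmax {x ∈ Q | pairQ θ x = (l : ℚ)} θ l ⟨hθgcd, hlpos, hQθ, rfl, toQ w,
      ⟨hSQ w hwS, by rw [pairQ_toQ, hθw]⟩, toQ s, ⟨hSQ s hsS, by rw [pairQ_toQ, hθs]⟩, ?_⟩
    intro h
    have := toQ_inj h
    subst this
    omega
  -- w is a vertex
  have hwv : toQ w ∈ vertices Q := by
    refine ⟨hSQ w hwS, ?_⟩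
    intro x hx y hy hxy
    obtain ⟨a, a', ha, ha', haa, hxyw⟩ := hxy
    have hlin : ∀ ζ : ℤ × ℤ, a * pairQ ζ x + a' * pairQ ζ y = pairZ ζ w := by
      intro ζ
      rw [← pairQ_toQ, ← hxyw]
      simp only [pairQ, Prod.fst_add, Prod.snd_add, Prod.smul_fst, Prod.smul_snd, smul_eq_mul]
      ring
    have htight : ∀ (ζ : ℤ × ℤ), (∀ z ∈ Q, pairQ ζ z ≤ (pairZ ζ w : ℚ)) →
        pairQ ζ x = pairZ ζ w := by
      intro ζ hζ
      have h1 := hlin ζ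
      have h2 := hζ x hx
      have h3 := mul_le_mul_of_nonneg_left (hζ y hy) ha'.le
      have h4 : a * (pairZ ζ w : ℚ) + a' * pairZ ζ w = pairZ ζ w := by
        rw [← add_mul, haa, one_mul]
      refine le_antisymm h2 (le_of_mul_le_mul_left ?_ ha)
      linarith
    have e1 := htight η (by rw [hwk]; exact hle)
    have e2 := htight θ (by rw [hθw]; exact hQθ)
    have e3 : pairQ ξ x = pairZ ξ w := by
      have hcq : (c : ℚ) ≠ 0 := by exact_mod_cast hc.ne'
      rw [hθQ, hθp, e1] at e2
      push_cast at e2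
      exact mul_left_cancel₀ hcq (by linarith)
    rw [← pairQ_toQ] at e1 e3
    have hdetQ : (ξ.1 : ℚ) * η.2 - ξ.2 * η.1 = D := by exact_mod_cast hdet
    have hDne : (D : ℚ) ≠ 0 := by
      have : D ≠ 0 := by rintro rfl; simp at hD
      exact_mod_cast this
    simp only [pairQ] at e1 e3
    refine Prod.ext (mul_left_cancel₀ hDne ?_) (mul_left_cancel₀ hDne ?_)
    · rw [← hdetQ]; linear_combination (η.2 : ℚ) * e3 - (ξ.2 : ℚ) * e1
    · rw [← hdetQ]; linear_combination (ξ.1 : ℚ) * e1 - (η.1 : ℚ) * e3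
  have hwprim : Int.gcd w.1 w.2 = 1 := by
    obtain ⟨p, hp, hpw⟩ := hprim _ hwv
    rw [toQ_inj hpw]; exact hp
  have hlc : l ≤ c * (k - 1) := by
    rcases (show c = 1 ∨ 2 ≤ c by omega) with h1 | h2
    · rw [h1, one_mul]
      by_contra! hcon
      have hlk' : l = k := by omega
      have hbk : b = k * (1 - d) := by rw [h1, hlk'] at hl; linarith
      have d1 : k ∣ w.1 := ⟨D * (η.2 * (1 - d) - ξ.2), by
        have e1 : pairZ ξ w = k * (1 - d) := by rw [← hb]; exact hbk
        simp only [pairZ] at e1 hwk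
        have : D * w.1 = η.2 * (k * (1 - d)) - ξ.2 * k := by
          rw [← hdet]; linear_combination η.2 * e1 - ξ.2 * hwk
        calc w.1 = D * D * w.1 := by rw [hD, one_mul]
          _ = D * (D * w.1) := by ring
          _ = _ := by rw [this]; ring⟩
      have d2 : k ∣ w.2 := ⟨D * (ξ.1 - η.1 * (1 - d)), by
        have e1 : pairZ ξ w = k * (1 - d) := by rw [← hb]; exact hbk
        simp only [pairZ] at e1 hwk
        have : D * w.2 = ξ.1 * k - η.1 * (k * (1 - d)) := by
          rw [← hdet]; linear_combination ξ.1 * hwk - η.1 * e1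
        calc w.2 = D * D * w.2 := by rw [hD, one_mul]
          _ = D * (D * w.2) := by ring
          _ = _ := by rw [this]; ring⟩
      have := Int.dvd_coe_gcd d1 d2
      rw [hwprim] at this
      have := Int.le_of_dvd (by norm_num) this
      push_cast at this
      omega
    · nlinarith
  have hQp : ∀ p, toQ p ∈ Q → c * pairZ ξ p + d * pairZ η p ≤ l := by
    intro p hp
    have := hQθ _ hp
    rw [pairQ_toQ, hθp] at this
    exact_mod_cast this
  refine ⟨b, ?_, ?_⟩
  · intro p hp hpk
    have := hQp p hp
    rw [hpk, hl] at this
    exact le_of_mul_le_mul_left (by linarith) hc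
  · intro p hp
    rcases le_or_gt 0 (pairZ η p) with h | h
    · exact Or.inr h
    left
    have h1 := hQp p hp
    generalize pairZ η p = Y at *
    generalize pairZ ξ p = X at *
    refine le_of_mul_le_mul_left ?_ hc
    have h2 := mul_le_mul_of_nonneg_left h1 (show 0 ≤ k by omega)
    have h3 := mul_le_mul_of_nonneg_left hlc (show 0 ≤ -Y + k by omega)
    have h4 : c * b = l - d * k := by linarith
    calc c * (-Y * b + k * X) = -Y * (c * b) + k * (c * X) := by ring
      _ = -Y * (l - d * k) + k * (c * X) := by rw [h4]
      _ ≤ (-Y + k) * l := by linarith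
      _ ≤ _ := by linarith

/-- If `Q` is an LDP-polygon of maximal local index `m_Q = k ≥ 2` and `F` is a facet
of local index `k`, then `|F ∩ ℤ²| ≤ 2k²`. -/
theorem facet_lattice_points_bound
    (Q : Set (ℚ × ℚ)) (F : Set (ℚ × ℚ)) (η : ℤ × ℤ) (k : ℤ)
    (hQ : IsLDPPolygon Q) (hk : 2 ≤ k) (hmax : HasMaxLocalIndex Q k)
    (hF : IsFacetWith Q η k F) :
    (latticeCount F : ℤ) ≤ 2 * k ^ 2 := by
  obtain ⟨⟨⟨⟨S, hS⟩, -⟩, h0⟩, hprim⟩ := hQ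
  obtain ⟨hη, -, hle, hFeq, x, hx, -⟩ := hF
  have hex : ∃ x ∈ Q, pairQ η x = (k : ℚ) := by
    rw [hFeq] at hx; exact ⟨x, hx⟩
  obtain ⟨u, v, huv⟩ := Int.isCoprime_iff_gcd_eq_one.2 hη
  obtain ⟨b, hb1, hb2⟩ := side_bound S Q hS h0 hprim k hk hmax.2 η (v, -u) 1 (by norm_num)
    (by simp only; linarith) hη hle hex
  obtain ⟨b', hb1', hb2'⟩ := side_bound S Q hS h0 hprim k hk hmax.2 η (-v, u) (-1) (by norm_num)
    (by simp only; linarith) hη hle hex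
  have hneg : ∀ p, pairZ (-v, u) p = - pairZ (v, -u) p := by
    intro p; simp only [pairZ]; ring
  simp only [hneg] at hb1' hb2'
  obtain ⟨s, hs, hpos⟩ := exists_vertex_pos S (hS ▸ h0) (-η.1, -η.2) (by simpa using hη)
  have hsneg : 1 ≤ - pairZ η s := by simp only [pairZ] at *; linarith
  have hsQ : toQ s ∈ Q := by rw [hS]; exact subset_convexHull ℚ _ ⟨s, hs, rfl⟩
  have g1 := (hb2 s hsQ).resolve_right (by omega)
  have g2 := (hb2' s hsQ).resolve_right (by omega)
  have hwidth : b + b' ≤ 2 * (k - 1) * (k + 1) := by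
    generalize - pairZ η s = h at *
    refine le_of_mul_le_mul_left ?_ (show 0 < h by omega)
    have : 0 ≤ (k - 1) * (k * (h - 1)) :=
      mul_nonneg (by omega) (mul_nonneg (by omega) (by omega))
    linarith
  have hcount : latticeCount F ≤ (Finset.Icc (-b') b).card := by
    rw [← Set.ncard_coe_finset]
    refine Set.ncard_le_ncard_of_injOn (fun p => pairZ (v, -u) p) ?_ ?_ (Finset.finite_toSet _)
    · intro p hp
      simp only [Set.mem_setOf_eq, hFeq, pairQ_toQ] at hp
      have hpk : pairZ η p = k := by exact_mod_cast hp.2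
      have h1 := hb1 p hp.1 hpk
      have h2 := hb1' p hp.1 hpk
      simp only [Finset.coe_Icc, Set.mem_Icc]
      constructor <;> linarith
    · intro p hp q hq hpq
      simp only [Set.mem_setOf_eq, hFeq, pairQ_toQ] at hp hq
      have hpk : pairZ η p = k := by exact_mod_cast hp.2
      have hqk : pairZ η q = k := by exact_mod_cast hq.2
      simp only [pairZ] at hpk hqk hpq
      refine Prod.ext ?_ ?_
      · linear_combination (q.1 - p.1) * huv + u * (hpk - hqk) + η.2 * hpq
      · linear_combination (q.2 - p.2) * huv + v * (hpk - hqk) - η.1 * hpq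
  rw [Int.card_Icc] at hcount
  have hk2 : 2 * (k - 1) * (k + 1) = 2 * k ^ 2 - 2 := by ring
  have hk3 : 0 ≤ k ^ 2 := sq_nonneg k
  omega
end

section
/- There are precisely thirty LDP-polygons of index ℓ_Q = 2, up to unimodular equivalence; that is, the set of LDP-polygons Q with ℓ_Q = 2 splits into exactly 30 equivalence classes under the action of GL(2,ℤ). -/
open Pointwise

/-! ## Basic tools about hulls of finite sets of lattice points -/

/-- The determinant of two lattice vectors. -/
def det2 (u v : ℤ × ℤ) : ℤ := u.1 * v.2 - u.2 * v.1

/-- The determinant of `v - u` and `w - u`. -/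
def det3 (u v w : ℤ × ℤ) : ℤ := (v.1 - u.1) * (w.2 - u.2) - (v.2 - u.2) * (w.1 - u.1)

/-- An integer matrix acting on a lattice point. -/
def app (a b c d : ℤ) (p : ℤ × ℤ) : ℤ × ℤ := (a * p.1 + b * p.2, c * p.1 + d * p.2)

/-- The convex hull of a finite set of lattice points. -/
def hull (V : Finset (ℤ × ℤ)) : Set (ℚ × ℚ) := convexHull ℚ (toQ '' (V : Set (ℤ × ℤ)))

lemma toQ_inj_s3 : Function.Injective toQ := by
  rintro ⟨a, b⟩ ⟨c, d⟩ h
  simp only [toQ, Prod.mk.injEq, Int.cast_inj] at h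
  exact Prod.ext h.1 h.2

lemma mem_hull {V : Finset (ℤ × ℤ)} {p : ℤ × ℤ} (h : p ∈ V) : toQ p ∈ hull V :=
  subset_convexHull ℚ _ ⟨p, h, rfl⟩

lemma convex_hull (V : Finset (ℤ × ℤ)) : Convex ℚ (hull V) := convex_convexHull ℚ _

lemma hull_subset {V : Finset (ℤ × ℤ)} {C : Set (ℚ × ℚ)} (hC : Convex ℚ C)
    (h : ∀ p ∈ V, toQ p ∈ C) : hull V ⊆ C := by
  apply convexHull_min _ hC
  rintro _ ⟨p, hp, rfl⟩
  exact h p hp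

lemma hull_eq {S V : Finset (ℤ × ℤ)} (h1 : V ⊆ S) (h2 : ∀ p ∈ S, toQ p ∈ hull V) :
    hull S = hull V :=
  Set.Subset.antisymm (hull_subset (convex_hull V) h2)
    (hull_subset (convex_hull S) fun p hp => mem_hull (h1 hp))

lemma pairQ_toQ_s3 (η p : ℤ × ℤ) : pairQ η (toQ p) = ((η.1 * p.1 + η.2 * p.2 : ℤ) : ℚ) := by
  simp [pairQ, toQ]

lemma pairQ_comb (η : ℤ × ℤ) (a b : ℚ) (x y : ℚ × ℚ) :
    pairQ η (a • x + b • y) = a * pairQ η x + b * pairQ η y := by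
  simp [pairQ]; ring

lemma convex_le (η : ℤ × ℤ) (l : ℚ) : Convex ℚ {x | pairQ η x ≤ l} := by
  rw [convex_iff_forall_pos]
  intro x hx y hy a b ha hb hab
  simp only [Set.mem_ofPred_eq, pairQ_comb] at *
  have : l = a * l + b * l := by rw [← add_mul, hab, one_mul]
  rw [this]; gcongr

lemma convex_lt (η : ℤ × ℤ) (l : ℚ) : Convex ℚ {x | pairQ η x < l} := by
  rw [convex_iff_forall_pos]
  intro x hx y hy a b ha hb hab
  simp only [Set.mem_ofPred_eq, pairQ_comb] at *
  have : l = a * l + b * l := by rw [← add_mul, hab, one_mul]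
  rw [this]; gcongr

lemma convex_lt_or (η : ℤ × ℤ) (u : ℚ × ℚ) :
    Convex ℚ {x | x = u ∨ pairQ η x < pairQ η u} := by
  rw [convex_iff_forall_pos]
  intro x hx y hy a b ha hb hab
  simp only [Set.mem_ofPred_eq, pairQ_comb] at *
  have hl : pairQ η u = a * pairQ η u + b * pairQ η u := by rw [← add_mul, hab, one_mul]
  rcases hx with rfl | hx
  · rcases hy with rfl | hy
    · left; rw [← add_smul, hab, one_smul]
    · right
      nlinarith [mul_lt_mul_of_pos_left hy hb]
  · right
    have hy' : pairQ η y ≤ pairQ η u := by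
      rcases hy with rfl | hy
      · rfl
      · exact hy.le
    nlinarith [mul_lt_mul_of_pos_left hx ha, mul_le_mul_of_nonneg_left hy' hb.le]

lemma hull_le_s3 {V : Finset (ℤ × ℤ)} {η : ℤ × ℤ} {l : ℤ}
    (h : ∀ w ∈ V, η.1 * w.1 + η.2 * w.2 ≤ l) : ∀ y ∈ hull V, pairQ η y ≤ (l : ℚ) := by
  intro y hy
  refine hull_subset (convex_le η l) ?_ hy
  intro p hp
  simp only [Set.mem_ofPred_eq, pairQ_toQ_s3]
  exact_mod_cast h p hp

/-- A vertex exposed by a linear functional is extreme. -/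
lemma exposed_extreme {V : Finset (ℤ × ℤ)} {p : ℤ × ℤ} (hp : p ∈ V) (η : ℤ × ℤ)
    (h : ∀ q ∈ V, q ≠ p → η.1 * q.1 + η.2 * q.2 < η.1 * p.1 + η.2 * p.2) :
    toQ p ∈ Set.extremePoints ℚ (hull V) := by
  have key : hull V ⊆ {x | x = toQ p ∨ pairQ η x < pairQ η (toQ p)} := by
    apply hull_subset (convex_lt_or _ _)
    intro q hq
    by_cases hqp : q = p
    · left; rw [hqp]
    · right
      rw [pairQ_toQ_s3, pairQ_toQ_s3]
      exact_mod_cast h q hq hqp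
  rw [mem_extremePoints_iff_left]
  refine ⟨mem_hull hp, ?_⟩
  rintro x hx y hy ⟨a, b, ha, hb, hab, hxy⟩
  by_contra hne
  have h1 : pairQ η x < pairQ η (toQ p) := by
    rcases key hx with h | h
    · exact absurd h hne
    · exact h
  have h2 : pairQ η y ≤ pairQ η (toQ p) := by
    rcases key hy with h | h
    · rw [h]
    · exact h.le
  have h3 := congrArg (pairQ η) hxy
  rw [pairQ_comb] at h3
  have hl : pairQ η (toQ p) = a * pairQ η (toQ p) + b * pairQ η (toQ p) := by
    rw [← add_mul, hab, one_mul]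
  nlinarith [mul_lt_mul_of_pos_left h1 ha, mul_le_mul_of_nonneg_left h2 hb.le]

/-- Every polytope is the hull of finitely many of its extreme points. -/
lemma exists_extreme_set (S0 : Finset (ℤ × ℤ)) :
    ∃ S : Finset (ℤ × ℤ), hull S0 = hull S ∧
      ∀ p ∈ S, toQ p ∈ Set.extremePoints ℚ (hull S) := by
  induction' hn : S0.card using Nat.strong_induction_on with n ih generalizing S0
  by_cases hall : ∀ p ∈ S0, toQ p ∈ Set.extremePoints ℚ (hull S0)
  · exact ⟨S0, rfl, hall⟩
  push Not at hall
  obtain ⟨p, hp, hpe⟩ := hall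
  have hmem : toQ p ∈ hull (S0.erase p) := by
    by_contra hnot
    apply hpe
    have hins : hull S0 = convexHull ℚ (insert (toQ p) (toQ '' (S0.erase p : Set (ℤ × ℤ)))) := by
      rw [← Set.image_insert_eq]
      unfold hull
      congr 2
      ext q
      by_cases hq : q = p <;> simp [hq, hp]
    by_cases hempty : (S0.erase p).Nonempty
    swap
    · rw [Finset.not_nonempty_iff_eq_empty] at hempty
      rw [hins, hempty]
      simp
    have hne : (toQ '' (S0.erase p : Set (ℤ × ℤ))).Nonempty := by
      obtain ⟨q, hq⟩ := hempty
      exact ⟨_, q, hq, rfl⟩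
    rw [convexHull_insert hne] at hins
    rw [mem_extremePoints_iff_left]
    refine ⟨mem_hull hp, ?_⟩
    rintro x hx y hy ⟨s, t, hs, ht, hst, hxy⟩
    rw [hins] at hx hy
    simp only [convexJoin_singleton_left, Set.mem_iUnion] at hx hy
    obtain ⟨k1, hk1, a1, b1, ha1, hb1, hab1, rfl⟩ := hx
    obtain ⟨k2, hk2, a2, b2, ha2, hb2, hab2, rfl⟩ := hy
    by_cases hβ : 0 < s * b1 + t * b2
    · exfalso
      apply hnot
      have hh := convex_hull (S0.erase p) hk1 hk2
        (a := s * b1 / (s * b1 + t * b2)) (b := t * b2 / (s * b1 + t * b2))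
        (by positivity) (by positivity) (by field_simp)
      convert hh using 1
      have e1 := congrArg Prod.fst hxy
      have e2 := congrArg Prod.snd hxy
      simp only [Prod.fst_add, Prod.snd_add, Prod.smul_fst, Prod.smul_snd, smul_eq_mul] at e1 e2
      have ea1 : a1 = 1 - b1 := by linarith
      have ea2 : a2 = 1 - b2 := by linarith
      have es : s = 1 - t := by linarith
      ext
      · simp only [Prod.fst_add, Prod.smul_fst, smul_eq_mul]
        field_simp
        subst ea1 ea2
        rw [es] at e1 ⊢
        linear_combination -e1
      · simp only [Prod.snd_add, Prod.smul_snd, smul_eq_mul]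
        field_simp
        subst ea1 ea2
        rw [es] at e2 ⊢
        linear_combination -e2
    · have hb0 : b1 = 0 := by
        by_contra hb
        have : 0 < b1 := lt_of_le_of_ne hb1 (Ne.symm hb)
        exact hβ (by positivity)
      have ha0 : a1 = 1 := by linarith
      rw [hb0, ha0]; simp
  obtain ⟨S, h1, h2⟩ := ih (S0.erase p).card
    (by rw [← hn]; exact Finset.card_erase_lt_of_mem hp) (S0.erase p) rfl
  refine ⟨S, ?_, h2⟩
  rw [← h1]
  apply hull_eq (Finset.erase_subset _ _)
  intro q hq
  by_cases hqp : q = p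
  · rw [hqp]; exact hmem
  · exact mem_hull (Finset.mem_erase.2 ⟨hqp, hq⟩)

/-- A point with nonnegative barycentric coordinates lies in a convex set. -/
lemma tri_mem {C : Set (ℚ × ℚ)} (hC : Convex ℚ C) {u v w x : ℚ × ℚ} (hu : u ∈ C) (hv : v ∈ C)
    (hw : w ∈ C)
    (h1 : 0 ≤ (v.1 - x.1) * (w.2 - x.2) - (v.2 - x.2) * (w.1 - x.1))
    (h2 : 0 ≤ (w.1 - x.1) * (u.2 - x.2) - (w.2 - x.2) * (u.1 - x.1))
    (h3 : 0 ≤ (u.1 - x.1) * (v.2 - x.2) - (u.2 - x.2) * (v.1 - x.1))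
    (hD : 0 < (v.1 - u.1) * (w.2 - u.2) - (v.2 - u.2) * (w.1 - u.1)) : x ∈ C := by
  set D := (v.1 - u.1) * (w.2 - u.2) - (v.2 - u.2) * (w.1 - u.1) with hDdef
  set A := (v.1 - x.1) * (w.2 - x.2) - (v.2 - x.2) * (w.1 - x.1) with hA
  set B := (w.1 - x.1) * (u.2 - x.2) - (w.2 - x.2) * (u.1 - x.1) with hB
  set E := (u.1 - x.1) * (v.2 - x.2) - (u.2 - x.2) * (v.1 - x.1) with hE
  have hsum : A + B + E = D := by rw [hA, hB, hE, hDdef]; ring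
  by_cases h0 : B + E = 0
  · have hB0 : B = 0 := by linarith
    have hE0 : E = 0 := by linarith
    have e1 : D * x.1 = D * u.1 := by
      have : D * x.1 = A * u.1 + B * v.1 + E * w.1 := by rw [hA, hB, hE, hDdef]; ring
      rw [this, ← hsum, hB0, hE0]; ring
    have e2 : D * x.2 = D * u.2 := by
      have : D * x.2 = A * u.2 + B * v.2 + E * w.2 := by rw [hA, hB, hE, hDdef]; ring
      rw [this, ← hsum, hB0, hE0]; ring
    have : x = u := Prod.ext (mul_left_cancel₀ hD.ne' e1) (mul_left_cancel₀ hD.ne' e2)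
    rw [this]; exact hu
  have hpos : 0 < B + E := lt_of_le_of_ne (by linarith) (Ne.symm h0)
  have hm : (B / (B + E)) • v + (E / (B + E)) • w ∈ C :=
    hC hv hw (by positivity) (by positivity) (by field_simp)
  have hm2 := hC hu hm (a := A / D) (b := (B + E) / D) (by positivity) (by positivity)
    (by rw [← add_div, ← add_assoc, hsum]; exact div_self hD.ne')
  convert hm2 using 1
  have e1 : D * x.1 = A * u.1 + B * v.1 + E * w.1 := by rw [hA, hB, hE, hDdef]; ring
  have e2 : D * x.2 = A * u.2 + B * v.2 + E * w.2 := by rw [hA, hB, hE, hDdef]; ring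
  clear_value A B E D
  ext
  · simp only [Prod.fst_add, Prod.smul_fst, smul_eq_mul]
    field_simp
    linear_combination e1
  · simp only [Prod.snd_add, Prod.smul_snd, smul_eq_mul]
    field_simp
    linear_combination e2

/-- Decidable criterion for lying in the hull. -/
def InTri (V : Finset (ℤ × ℤ)) (p : ℤ × ℤ) : Prop :=
  ∃ u ∈ V, ∃ v ∈ V, ∃ w ∈ V, 0 < det3 u v w ∧ 0 ≤ det3 p v w ∧ 0 ≤ det3 p w u ∧ 0 ≤ det3 p u v

instance (V : Finset (ℤ × ℤ)) (p : ℤ × ℤ) : Decidable (InTri V p) := by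
  unfold InTri; infer_instance

lemma InTri.mem {V : Finset (ℤ × ℤ)} {p : ℤ × ℤ} (h : InTri V p) : toQ p ∈ hull V := by
  obtain ⟨u, hu, v, hv, w, hw, h0, h1, h2, h3⟩ := h
  refine tri_mem (convex_hull V) (mem_hull hu) (mem_hull hv) (mem_hull hw) ?_ ?_ ?_ ?_ <;>
    simp only [toQ] <;> unfold det3 at * <;> exact_mod_cast (by assumption)

/-- A criterion for the origin to be an interior point. -/
lemma zero_mem_interior {C : Set (ℚ × ℚ)} (hC : Convex ℚ C) {u v w : ℚ × ℚ} (hu : u ∈ C)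
    (hv : v ∈ C) (hw : w ∈ C) (h1 : 0 < v.1 * w.2 - v.2 * w.1) (h2 : 0 < w.1 * u.2 - w.2 * u.1)
    (h3 : 0 < u.1 * v.2 - u.2 * v.1) : (0 : ℚ × ℚ) ∈ interior C := by
  rw [mem_interior_iff_mem_nhds]
  have c1 : Continuous fun x : ℚ × ℚ =>
    (v.1 - x.1) * (w.2 - x.2) - (v.2 - x.2) * (w.1 - x.1) := by fun_prop
  have c2 : Continuous fun x : ℚ × ℚ =>
    (w.1 - x.1) * (u.2 - x.2) - (w.2 - x.2) * (u.1 - x.1) := by fun_prop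
  have c3 : Continuous fun x : ℚ × ℚ =>
    (u.1 - x.1) * (v.2 - x.2) - (u.2 - x.2) * (v.1 - x.1) := by fun_prop
  have n1 := (c1.tendsto 0).eventually (lt_mem_nhds (a := 0) (by simpa using h1))
  have n2 := (c2.tendsto 0).eventually (lt_mem_nhds (a := 0) (by simpa using h2))
  have n3 := (c3.tendsto 0).eventually (lt_mem_nhds (a := 0) (by simpa using h3))
  filter_upwards [n1, n2, n3] with x i1 i2 i3
  exact tri_mem hC hu hv hw i1.le i2.le i3.le (by nlinarith)

/-- A facet of a hull contains two of the given points. -/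
lemma facet_points {V : Finset (ℤ × ℤ)} {η : ℤ × ℤ} {l : ℤ} {F : Set (ℚ × ℚ)}
    (h : IsFacetWith (hull V) η l F) :
    (∀ w ∈ V, η.1 * w.1 + η.2 * w.2 ≤ l) ∧ ∃ u ∈ V, ∃ v ∈ V, u ≠ v ∧
      η.1 * u.1 + η.2 * u.2 = l ∧ η.1 * v.1 + η.2 * v.2 = l := by
  obtain ⟨-, -, hle, rfl, x, ⟨hx, hxl⟩, y, ⟨hy, hyl⟩, hxy⟩ := h
  have hle' : ∀ w ∈ V, η.1 * w.1 + η.2 * w.2 ≤ l := by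
    intro w hw
    have := hle _ (mem_hull hw)
    rw [pairQ_toQ_s3] at this
    exact_mod_cast this
  refine ⟨hle', ?_⟩
  by_cases hex : ∃ u ∈ V, η.1 * u.1 + η.2 * u.2 = l
  · obtain ⟨u, hu, hul⟩ := hex
    have hul' : pairQ η (toQ u) = l := by rw [pairQ_toQ_s3, hul]
    by_contra hcon
    push Not at hcon
    have key : hull V ⊆ {x | x = toQ u ∨ pairQ η x < pairQ η (toQ u)} := by
      apply hull_subset (convex_lt_or _ _)
      intro q hq
      by_cases hqp : u = q
      · left; rw [hqp]
      · right
        rw [hul', pairQ_toQ_s3]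
        exact_mod_cast lt_of_le_of_ne (hle' q hq) (hcon u hu q hq hqp hul)
    have hxu : x = toQ u := by
      rcases key hx with h | h
      · exact h
      · rw [hul', hxl] at h; exact absurd h (lt_irrefl _)
    have hyu : y = toQ u := by
      rcases key hy with h | h
      · exact h
      · rw [hul', hyl] at h; exact absurd h (lt_irrefl _)
    exact hxy (hxu.trans hyu.symm)
  · push Not at hex
    have key : hull V ⊆ {x | pairQ η x < (l : ℚ)} := by
      apply hull_subset (convex_lt _ _)
      intro q hq
      simp only [Set.mem_ofPred_eq, pairQ_toQ_s3]
      exact_mod_cast lt_of_le_of_ne (hle' q hq) (hex q hq)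
    have := key hx
    simp only [Set.mem_ofPred_eq, hxl] at this
    exact absurd this (lt_irrefl _)

/-! ## Unimodular maps -/

/-- The linear map attached to an integer matrix. -/
def lin (a b c d : ℤ) : (ℚ × ℚ) →ₗ[ℚ] (ℚ × ℚ) where
  toFun x := ((a : ℚ) * x.1 + (b : ℚ) * x.2, (c : ℚ) * x.1 + (d : ℚ) * x.2)
  map_add' x y := by ext <;> simp <;> ring
  map_smul' t x := by ext <;> simp <;> ring

lemma lin_toQ (a b c d : ℤ) (p : ℤ × ℤ) : lin a b c d (toQ p) = toQ (app a b c d p) := by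
  simp [lin, toQ, app]

lemma lin_hull (a b c d : ℤ) (V : Finset (ℤ × ℤ)) :
    lin a b c d '' hull V = hull (V.image (app a b c d)) := by
  unfold hull
  rw [LinearMap.image_convexHull, Finset.coe_image, Set.image_image, Set.image_image]
  simp only [lin_toQ]

lemma unimod_iff (Q Q' : Set (ℚ × ℚ)) : UnimodEquiv Q Q' ↔
    ∃ a b c d : ℤ, (a * d - b * c = 1 ∨ a * d - b * c = -1) ∧ lin a b c d '' Q = Q' := Iff.rfl

lemma unimod_refl (Q : Set (ℚ × ℚ)) : UnimodEquiv Q Q := by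
  rw [unimod_iff]
  refine ⟨1, 0, 0, 1, by norm_num, ?_⟩
  have : ⇑(lin 1 0 0 1) = id := by funext x; simp [lin]
  rw [this, Set.image_id]

lemma unimod_trans {Q Q' Q'' : Set (ℚ × ℚ)} (h : UnimodEquiv Q Q') (h' : UnimodEquiv Q' Q'') :
    UnimodEquiv Q Q'' := by
  rw [unimod_iff] at *
  obtain ⟨a, b, c, d, hd, rfl⟩ := h
  obtain ⟨a', b', c', d', hd', rfl⟩ := h'
  refine ⟨a' * a + b' * c, a' * b + b' * d, c' * a + d' * c, c' * b + d' * d, ?_, ?_⟩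
  · have : (a' * a + b' * c) * (c' * b + d' * d) - (a' * b + b' * d) * (c' * a + d' * c)
        = (a' * d' - b' * c') * (a * d - b * c) := by ring
    rw [this]
    rcases hd with h | h <;> rcases hd' with h' | h' <;> rw [h, h'] <;> norm_num
  · rw [Set.image_image]
    congr 1
    funext x
    simp only [lin, LinearMap.coe_mk, AddHom.coe_mk]
    push_cast
    ext <;> simp <;> ring

lemma unimod_image (V : Finset (ℤ × ℤ)) {a b c d : ℤ}
    (h : a * d - b * c = 1 ∨ a * d - b * c = -1) :
    UnimodEquiv (hull V) (hull (V.image (app a b c d))) := by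
  rw [unimod_iff]
  exact ⟨a, b, c, d, h, lin_hull a b c d V⟩

lemma app_inj {a b c d : ℤ} (h : a * d - b * c = 1 ∨ a * d - b * c = -1) :
    Function.Injective (app a b c d) := by
  rintro ⟨x, y⟩ ⟨x', y'⟩ he
  simp only [app, Prod.mk.injEq] at he
  obtain ⟨e1, e2⟩ := he
  rcases h with h | h
  · ext
    · show x = x'
      linear_combination d * e1 - b * e2 + (x' - x) * h
    · show y = y'
      linear_combination a * e2 - c * e1 + (y' - y) * h
  · ext
    · show x = x'
      linear_combination -d * e1 + b * e2 - (x' - x) * h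
    · show y = y'
      linear_combination -a * e2 + c * e1 - (y' - y) * h

/-- The inverse-free linear equivalence attached to a unimodular matrix. -/
noncomputable def linE (a b c d : ℤ) (h : a * d - b * c = 1 ∨ a * d - b * c = -1) :
    (ℚ × ℚ) ≃ₗ[ℚ] (ℚ × ℚ) :=
  LinearEquiv.ofBijective (lin a b c d) (by
    have hq : ((a : ℚ) * d - b * c) * ((a : ℚ) * d - b * c) = 1 := by
      rcases h with h | h
      · have : ((a : ℚ) * d - b * c) = 1 := by exact_mod_cast h
        rw [this]; norm_num
      · have : ((a : ℚ) * d - b * c) = -1 := by exact_mod_cast h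
        rw [this]; norm_num
    constructor
    · rintro ⟨x, y⟩ ⟨x', y'⟩ he
      simp only [lin, LinearMap.coe_mk, AddHom.coe_mk, Prod.mk.injEq] at he
      obtain ⟨e1, e2⟩ := he
      ext
      · show x = x'
        linear_combination ((a : ℚ) * d - b * c) * (d * e1 - b * e2) + (x' - x) * hq
      · show y = y'
        linear_combination ((a : ℚ) * d - b * c) * (a * e2 - c * e1) + (y' - y) * hq
    · rintro ⟨x, y⟩
      refine ⟨(((a : ℚ) * d - b * c) * (d * x - b * y),
        ((a : ℚ) * d - b * c) * (a * y - c * x)), ?_⟩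
      simp only [lin, LinearMap.coe_mk, AddHom.coe_mk]
      ext
      · show _ = x
        simp only
        linear_combination x * hq
      · show _ = y
        simp only
        linear_combination y * hq)

/-- An invariant of a finite set of lattice points. -/
def inv (V : Finset (ℤ × ℤ)) : ℕ :=
  ∑ u ∈ V, ∑ v ∈ V, (det2 u v).natAbs ^ 3 * Int.gcd (v.1 - u.1) (v.2 - u.2)

lemma gcd_app {a b c d : ℤ} (h : a * d - b * c = 1 ∨ a * d - b * c = -1) (x y : ℤ) :
    Int.gcd (a * x + b * y) (c * x + d * y) = Int.gcd x y := by
  apply Nat.dvd_antisymm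
  · apply Int.dvd_gcd
    · have h1 := dvd_mul_of_dvd_right (Int.gcd_dvd_left (a * x + b * y) (c * x + d * y)) d
      have h2 := dvd_mul_of_dvd_right (Int.gcd_dvd_right (a * x + b * y) (c * x + d * y)) b
      obtain ⟨k, hk⟩ := dvd_sub h1 h2
      rcases h with h | h
      · exact ⟨k, by linear_combination hk - x * h⟩
      · exact ⟨-k, by linear_combination -hk + x * h⟩
    · have h1 := dvd_mul_of_dvd_right (Int.gcd_dvd_left (a * x + b * y) (c * x + d * y)) c
      have h2 := dvd_mul_of_dvd_right (Int.gcd_dvd_right (a * x + b * y) (c * x + d * y)) a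
      obtain ⟨k, hk⟩ := dvd_sub h2 h1
      rcases h with h | h
      · exact ⟨k, by linear_combination hk - y * h⟩
      · exact ⟨-k, by linear_combination -hk + y * h⟩
  · apply Int.dvd_gcd
    · exact dvd_add (dvd_mul_of_dvd_right (Int.gcd_dvd_left x y) _)
        (dvd_mul_of_dvd_right (Int.gcd_dvd_right x y) _)
    · exact dvd_add (dvd_mul_of_dvd_right (Int.gcd_dvd_left x y) _)
        (dvd_mul_of_dvd_right (Int.gcd_dvd_right x y) _)

lemma inv_image {a b c d : ℤ} (h : a * d - b * c = 1 ∨ a * d - b * c = -1)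
    (V : Finset (ℤ × ℤ)) : inv (V.image (app a b c d)) = inv V := by
  unfold inv
  rw [Finset.sum_image (fun x _ y _ e => app_inj h e)]
  refine Finset.sum_congr rfl fun u _ => ?_
  rw [Finset.sum_image (fun x _ y _ e => app_inj h e)]
  refine Finset.sum_congr rfl fun v _ => ?_
  have h1 : (det2 (app a b c d u) (app a b c d v)).natAbs = (det2 u v).natAbs := by
    have : det2 (app a b c d u) (app a b c d v) = (a * d - b * c) * det2 u v := by
      simp only [det2, app]; ring
    rw [this, Int.natAbs_mul]
    rcases h with h | h <;> rw [h] <;> simp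
  have h2 : Int.gcd ((app a b c d v).1 - (app a b c d u).1) ((app a b c d v).2 - (app a b c d u).2)
      = Int.gcd (v.1 - u.1) (v.2 - u.2) := by
    rw [← gcd_app h (v.1 - u.1) (v.2 - u.2)]
    simp only [app]
    congr 1 <;> ring
  rw [h1, h2]

lemma inv_eq_of_unimod {V W : Finset (ℤ × ℤ)}
    (hV : ∀ p ∈ V, toQ p ∈ Set.extremePoints ℚ (hull V))
    (hW : ∀ p ∈ W, toQ p ∈ Set.extremePoints ℚ (hull W))
    (h : UnimodEquiv (hull V) (hull W)) : inv V = inv W := by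
  have eV : Set.extremePoints ℚ (hull V) = toQ '' (V : Set (ℤ × ℤ)) := by
    apply Set.Subset.antisymm extremePoints_convexHull_subset
    rintro _ ⟨p, hp, rfl⟩
    exact hV p hp
  have eW : Set.extremePoints ℚ (hull W) = toQ '' (W : Set (ℤ × ℤ)) := by
    apply Set.Subset.antisymm extremePoints_convexHull_subset
    rintro _ ⟨p, hp, rfl⟩
    exact hW p hp
  rw [unimod_iff] at h
  obtain ⟨a, b, c, d, hd, he⟩ := h
  have h1 := image_extremePoints (𝕜 := ℚ) (linE a b c d hd) (hull V)
  have hcoe : ⇑(linE a b c d hd) = ⇑(lin a b c d) := rfl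
  rw [hcoe, he, eV, eW, Set.image_image] at h1
  simp only [lin_toQ] at h1
  rw [← Set.image_image toQ, toQ_inj_s3.image_injective.eq_iff] at h1
  have h2 : V.image (app a b c d) = W := by
    rw [← Finset.coe_inj, Finset.coe_image]; exact h1
  rw [← h2, inv_image hd]

/-! ## The thirty representatives -/

/-- The first family of polygons in the strip `|x| ≤ 1`. -/
def f0 (r l : ℤ) : Finset (ℤ × ℤ) := {(1, 2), (-1, 2), (1, r), (-1, l)}

/-- The second family of polygons in the strip `|x| ≤ 1`. -/
def f1 (r l : ℤ) : Finset (ℤ × ℤ) := {(1, 2), (-1, 2), (1, r), (-1, l), (0, -1)}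

/-- The vertex sets of the thirty polygons. -/
def rep : Fin 30 → Finset (ℤ × ℤ) :=
  ![f0 (-3) 2, f0 (-2) 1, f0 (-1) 0, f0 (-4) 2, f0 (-3) 1, f0 (-2) 0, f0 (-1) (-1),
    f0 (-6) 2, f0 (-5) 1, f0 (-4) 0, f0 (-3) (-1), f0 (-2) (-2),
    f1 (-3) 2, f1 (-2) 2, f1 (-1) 2, f1 0 2, f1 1 2, f1 2 2,
    f1 (-2) 1, f1 (-1) 1, f1 0 1, f1 1 1, f1 (-1) 0, f1 0 0,
    {(-1, -2), (-1, 2), (3, 2)}, {(-1, -1), (0, -1), (3, 2), (-1, 2)},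
    {(-1, -1), (-1, 2), (3, 2)}, {(-1, -1), (-1, 2), (3, 2), (1, 0)},
    {(-1, -1), (-1, 2), (3, 2), (2, 1)}, {(-1, -1), (-1, 2), (5, 2)}]

/-- Decidable conditions ensuring that the hull is an LDP-polygon of index two. -/
structure RepOK (V : Finset (ℤ × ℤ)) : Prop where
  prim : ∀ p ∈ V, Int.gcd p.1 p.2 = 1
  int : ∃ u ∈ V, ∃ v ∈ V, ∃ p ∈ V, ∃ q ∈ V, 0 < det2 u v ∧ 0 < det2 v (p.1 + q.1, p.2 + q.2) ∧
    0 < det2 (p.1 + q.1, p.2 + q.2) u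
  edge : ∀ u ∈ V, ∀ v ∈ V, u ≠ v → (∀ w ∈ V, 0 ≤ det3 u v w) →
    det2 u v ∣ 2 * (Int.gcd (v.1 - u.1) (v.2 - u.2) : ℤ)
  top : ∀ w ∈ V, w.2 ≤ 2
  two : ∃ u ∈ V, ∃ v ∈ V, u ≠ v ∧ u.2 = 2 ∧ v.2 = 2

lemma RepOK.ldp {V : Finset (ℤ × ℤ)} (h : RepOK V) : IsLDPPolygon (hull V) := by
  have hint : (0 : ℚ × ℚ) ∈ interior (hull V) := by
    obtain ⟨u, hu, v, hv, p, hp, q, hq, h1, h2, h3⟩ := h.int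
    have hm : (1 / 2 : ℚ) • toQ p + (1 / 2 : ℚ) • toQ q ∈ hull V :=
      convex_hull V (mem_hull hp) (mem_hull hq) (by norm_num) (by norm_num) (by norm_num)
    unfold det2 at h1 h2 h3
    have g1 : (0 : ℚ) < u.1 * v.2 - u.2 * v.1 := by exact_mod_cast h1
    have g2 : (0 : ℚ) < v.1 * (p.2 + q.2) - v.2 * (p.1 + q.1) := by exact_mod_cast h2
    have g3 : (0 : ℚ) < (p.1 + q.1) * u.2 - (p.2 + q.2) * u.1 := by exact_mod_cast h3
    refine zero_mem_interior (convex_hull V) (mem_hull hu) (mem_hull hv) hm ?_ ?_ ?_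
    · simp [toQ]; linarith
    · simp [toQ]; linarith
    · simp [toQ]; linarith
  refine ⟨⟨⟨⟨V, rfl⟩, ⟨0, hint⟩⟩, hint⟩, ?_⟩
  intro v hv
  obtain ⟨p, hp, rfl⟩ := extremePoints_convexHull_subset hv
  exact ⟨p, h.prim p hp, rfl⟩

lemma perp_of_prim {e f x y : ℤ} (hp : Int.gcd e f = 1) (h : e * x + f * y = 0) :
    ∃ k, x = -(k * f) ∧ y = k * e := by
  obtain ⟨s, t, hst⟩ := Int.isCoprime_iff_gcd_eq_one.2 hp
  refine ⟨s * y - t * x, ?_, ?_⟩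
  · linear_combination -x * hst + s * h
  · linear_combination -y * hst + t * h

lemma gcd_perp {e f k : ℤ} (hp : Int.gcd e f = 1) (hk : 0 < k) :
    (Int.gcd (-(k * f)) (k * e) : ℤ) = k := by
  rw [Int.neg_gcd]
  rw [Int.gcd_mul_left, Int.gcd_comm, hp]
  simp [abs_of_pos hk]

lemma RepOK.index {V : Finset (ℤ × ℤ)} (h : RepOK V) : HasIndex (hull V) 2 := by
  refine ⟨by norm_num, ?_, ?_⟩
  · intro F η l hF
    obtain ⟨hle, u, hu, v, hv, huv, hul, hvl⟩ := facet_points hF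
    obtain ⟨k, hk1, hk2⟩ := perp_of_prim (x := v.1 - u.1) (y := v.2 - u.2) hF.1
      (by linear_combination hvl - hul)
    -- reduce to the positively oriented pair
    have main : ∀ u ∈ V, ∀ v ∈ V, u ≠ v → η.1 * u.1 + η.2 * u.2 = l → ∀ k : ℤ, 0 < k →
        v.1 - u.1 = -(k * η.2) → v.2 - u.2 = k * η.1 → l ∣ 2 := by
      intro u hu v hv huv hul k hk hk1 hk2
      have hone : ∀ w ∈ V, 0 ≤ det3 u v w := by
        intro w hw
        have e : det3 u v w = k * (l - (η.1 * w.1 + η.2 * w.2)) := by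
          unfold det3
          rw [hk1, hk2, ← hul]; ring
        rw [e]
        exact mul_nonneg hk.le (by linarith [hle w hw])
      have hd := h.edge u hu v hv huv hone
      have e : det2 u v = k * l := by
        have : det2 u v = u.1 * (v.2 - u.2) - u.2 * (v.1 - u.1) := by unfold det2; ring
        rw [this, hk1, hk2, ← hul]; ring
      rw [e, hk1, hk2, gcd_perp hF.1 hk, mul_comm 2 k] at hd
      exact (mul_dvd_mul_iff_left hk.ne').1 hd
    rcases lt_trichotomy k 0 with hk | hk | hk
    · exact main v hv u hu huv.symm hvl (-k) (by linarith) (by linarith) (by linarith)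
    · exfalso
      rw [hk] at hk1 hk2
      exact huv (Prod.ext (by linarith) (by linarith))
    · exact main u hu v hv huv hul k hk hk1 hk2
  · intro m _ hm
    obtain ⟨u, hu, v, hv, huv, h1, h2⟩ := h.two
    refine hm {x ∈ hull V | pairQ (0, 1) x = ((2 : ℤ) : ℚ)} (0, 1) 2
      ⟨by norm_num, by norm_num, hull_le_s3 ?_, rfl, ?_⟩
    · intro w hw
      simpa using h.top w hw
    · refine ⟨toQ u, ⟨mem_hull hu, ?_⟩, toQ v, ⟨mem_hull hv, ?_⟩, fun e => huv (toQ_inj_s3 e)⟩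
      · rw [pairQ_toQ_s3]; simp [h1]
      · rw [pairQ_toQ_s3]; simp [h2]

lemma rep_ok (i : Fin 30) : RepOK (rep i) := by
  have h1 : ∀ i, ∀ p ∈ rep i, Int.gcd p.1 p.2 = 1 := by decide +kernel
  have h2 : ∀ i, ∃ u ∈ rep i, ∃ v ∈ rep i, ∃ p ∈ rep i, ∃ q ∈ rep i, 0 < det2 u v ∧
    0 < det2 v (p.1 + q.1, p.2 + q.2) ∧ 0 < det2 (p.1 + q.1, p.2 + q.2) u := by
    unfold det2; decide +kernel
  have h3 : ∀ i, ∀ u ∈ rep i, ∀ v ∈ rep i, u ≠ v → (∀ w ∈ rep i, 0 ≤ det3 u v w) →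
    det2 u v ∣ 2 * (Int.gcd (v.1 - u.1) (v.2 - u.2) : ℤ) := by
    unfold det2 det3; decide +kernel
  have h4 : ∀ i, ∀ w ∈ rep i, w.2 ≤ 2 := by decide +kernel
  have h5 : ∀ i, ∃ u ∈ rep i, ∃ v ∈ rep i, u ≠ v ∧ u.2 = 2 ∧ v.2 = 2 := by decide +kernel
  exact ⟨h1 i, h2 i, h3 i, h4 i, h5 i⟩

lemma rep_extreme (i : Fin 30) : ∀ p ∈ rep i, toQ p ∈ Set.extremePoints ℚ (hull (rep i)) := by
  have h : ∀ i, ∀ p ∈ rep i, ∃ a ∈ Finset.Icc (-5 : ℤ) 5, ∃ b ∈ Finset.Icc (-5 : ℤ) 5,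
      ∀ q ∈ rep i, q ≠ p → a * q.1 + b * q.2 < a * p.1 + b * p.2 := by
    decide +kernel
  intro p hp
  obtain ⟨a, -, b, -, hab⟩ := h i p hp
  exact exposed_extreme hp (a, b) hab

lemma rep_inv : ∀ i j, inv (rep i) = inv (rep j) → i = j := by
  decide +kernel

lemma rep_inequiv (i j : Fin 30) (h : UnimodEquiv (hull (rep i)) (hull (rep j))) : i = j :=
  rep_inv i j (inv_eq_of_unimod (rep_extreme i) (rep_extreme j) h)

/-! ## The classification -/

/-- The combinatorial conditions satisfied by the vertex set. -/
structure Good (S : Finset (ℤ × ℤ)) : Prop where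
  prim : ∀ p ∈ S, Int.gcd p.1 p.2 = 1
  pos : ∀ a b : ℤ, (a ≠ 0 ∨ b ≠ 0) → ∃ w ∈ S, 0 < a * w.1 + b * w.2
  edge : ∀ u ∈ S, ∀ v ∈ S, 0 < det2 u v → (∀ w ∈ S, 0 ≤ det3 u v w) →
    ∃ k s t : ℤ, v.1 - u.1 = k * s ∧ v.2 - u.2 = k * t ∧ (det2 u v = k ∨ det2 u v = 2 * k)

lemma Good.image {S : Finset (ℤ × ℤ)} (h : Good S) {a b c d : ℤ} (hd : a * d - b * c = 1) :
    Good (S.image (app a b c d)) := by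
  have hdet2 : ∀ u v, det2 (app a b c d u) (app a b c d v) = det2 u v := by
    intro u v
    simp only [det2, app]
    linear_combination (u.1 * v.2 - u.2 * v.1) * hd
  have hdet3 : ∀ u v w, det3 (app a b c d u) (app a b c d v) (app a b c d w) = det3 u v w := by
    intro u v w
    simp only [det3, app]
    linear_combination ((v.1 - u.1) * (w.2 - u.2) - (v.2 - u.2) * (w.1 - u.1)) * hd
  refine ⟨?_, ?_, ?_⟩
  · simp only [Finset.forall_mem_image]
    intro p hp
    simp only [app]
    rw [gcd_app (Or.inl hd)]
    exact h.prim p hp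
  · intro e f hef
    obtain ⟨w, hw, hpos⟩ := h.pos (e * a + f * c) (e * b + f * d) (by
      by_contra hcon
      push Not at hcon
      obtain ⟨h1, h2⟩ := hcon
      have he : e = 0 := by linear_combination d * h1 - c * h2 - e * hd
      have hf : f = 0 := by linear_combination a * h2 - b * h1 - f * hd
      rcases hef with h | h
      · exact h he
      · exact h hf)
    refine ⟨app a b c d w, Finset.mem_image_of_mem _ hw, ?_⟩
    simp only [app]
    linarith
  · simp only [Finset.forall_mem_image, hdet2, hdet3]
    intro u hu v hv h1 h2
    obtain ⟨k, s, t, e1, e2, e3⟩ := h.edge u hu v hv h1 h2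
    refine ⟨k, a * s + b * t, c * s + d * t, ?_, ?_, e3⟩
    · simp only [app]
      linear_combination a * e1 + b * e2
    · simp only [app]
      linear_combination c * e1 + d * e2

/-- The vertex set of an LDP-polygon of index two is good. -/
lemma good_of_ldp {S : Finset (ℤ × ℤ)} (hS : ∀ p ∈ S, toQ p ∈ Set.extremePoints ℚ (hull S))
    (hL : IsLDPPolygon (hull S)) (hI : HasIndex (hull S) 2) : Good S := by
  refine ⟨?_, ?_, ?_⟩
  · intro p hp
    obtain ⟨q, hq, hpq⟩ := hL.2 _ (hS p hp)
    rw [toQ_inj_s3 hpq]; exact hq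
  · intro a b hab
    by_contra hcon
    push Not at hcon
    have hle := hull_le_s3 (η := (a, b)) (l := 0) hcon
    have h0 := mem_interior_iff_mem_nhds.1 hL.1.2
    have hc : Continuous fun t : ℚ => ((t * a, t * b) : ℚ × ℚ) := by fun_prop
    have hz : ((0 * (a : ℚ), 0 * (b : ℚ)) : ℚ × ℚ) = 0 := by simp
    have hev : ∀ᶠ t in nhds (0 : ℚ), ((t * a, t * b) : ℚ × ℚ) ∈ hull S :=
      (hc.tendsto 0) (by rw [hz]; exact h0)
    have hev' : ∀ᶠ t in nhdsWithin (0 : ℚ) (Set.Ioi 0), ((t * a, t * b) : ℚ × ℚ) ∈ hull S :=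
      hev.filter_mono nhdsWithin_le_nhds
    obtain ⟨t, ht1, ht2⟩ := (hev'.and self_mem_nhdsWithin).exists
    have h1 := hle _ ht1
    simp only [pairQ, Int.cast_zero] at h1
    have ht : (0 : ℚ) < t := ht2
    have h2 : (0 : ℚ) < a * a + b * b := by
      have : (0 : ℤ) < a * a + b * b := by
        rcases hab with h | h
        · nlinarith [mul_self_pos.2 h, mul_self_nonneg b]
        · nlinarith [mul_self_pos.2 h, mul_self_nonneg a]
      exact_mod_cast this
    nlinarith [mul_pos ht h2]
  · intro u hu v hv hpos hone
    have huv : 0 < Int.gcd (v.2 - u.2) (-(v.1 - u.1)) := by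
      rw [Int.gcd_pos_iff]
      by_contra hcon
      push Not at hcon
      obtain ⟨h1, h2⟩ := hcon
      have : det2 u v = 0 := by
        have e1 : v.2 = u.2 := by linarith
        have e2 : v.1 = u.1 := by linarith
        unfold det2; rw [e1, e2]; ring
      omega
    obtain ⟨e, f, hef, h1, h2⟩ := Int.exists_gcd_one huv
    set g : ℤ := (Int.gcd (v.2 - u.2) (-(v.1 - u.1)) : ℤ) with hg
    have hgpos : 0 < g := by rw [hg]; exact_mod_cast huv
    have hdu : det2 u v = g * (e * u.1 + f * u.2) := by
      unfold det2; linear_combination u.1 * h1 + u.2 * h2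
    have hdv : det2 u v = g * (e * v.1 + f * v.2) := by
      unfold det2; linear_combination v.1 * h1 + v.2 * h2
    have hlpos : 0 < e * u.1 + f * u.2 := by
      rw [hdu] at hpos
      exact pos_of_mul_pos_right hpos hgpos.le
    have hleq : e * v.1 + f * v.2 = e * u.1 + f * u.2 := by
      rw [hdu] at hdv
      exact (mul_left_cancel₀ hgpos.ne' hdv).symm
    have hdvd := hI.2.1 {x ∈ hull S | pairQ (e, f) x = ((e * u.1 + f * u.2 : ℤ) : ℚ)} (e, f)
      (e * u.1 + f * u.2) ⟨hef, hlpos, hull_le_s3 (by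
        intro w hw
        have := hone w hw
        have e3 : det3 u v w = g * ((e * u.1 + f * u.2) - (e * w.1 + f * w.2)) := by
          unfold det3; linear_combination (u.1 - w.1) * h1 + (u.2 - w.2) * h2
        rw [e3] at this
        have := nonneg_of_mul_nonneg_right this hgpos
        show e * w.1 + f * w.2 ≤ _
        linarith), rfl, toQ u, ⟨mem_hull hu, by rw [pairQ_toQ_s3]⟩, toQ v,
        ⟨mem_hull hv, by rw [pairQ_toQ_s3]; simp only; rw [hleq]⟩, by
          intro he
          have := toQ_inj_s3 he
          rw [this] at hpos
          unfold det2 at hpos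
          nlinarith⟩
    have hl2 := Int.le_of_dvd (by norm_num) hdvd
    refine ⟨g, -f, e, by linarith, by linarith, ?_⟩
    have : e * u.1 + f * u.2 = 1 ∨ e * u.1 + f * u.2 = 2 := by omega
    rcases this with h | h
    · left; rw [hdu, h]; ring
    · right; rw [hdu, h]; ring

/-- The hull of `V` is, up to an explicit reflection, one of the representatives. -/
def Cls (V : Finset (ℤ × ℤ)) : Prop :=
  ∃ i, rep i = V ∨ rep i = V.image (app (-1) 0 0 1) ∨ rep i = V.image (app (-1) 1 0 1)

instance (V : Finset (ℤ × ℤ)) : Decidable (Cls V) := by unfold Cls; infer_instance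

lemma Cls.unimod {V : Finset (ℤ × ℤ)} (h : Cls V) : ∃ i, UnimodEquiv (hull V) (hull (rep i)) := by
  obtain ⟨i, h | h | h⟩ := h
  · exact ⟨i, by rw [h]; exact unimod_refl _⟩
  · exact ⟨i, by rw [h]; exact unimod_image V (by norm_num)⟩
  · exact ⟨i, by rw [h]; exact unimod_image V (by norm_num)⟩

lemma bound_aux {b s t x y : ℤ} (hb : ∃ m, b = 2 * m + 1) (ht : 0 < t)
    (h : b * t - 2 * s = 1 ∨ b * t - 2 * s = 2) (hy : y ≤ 2)
    (hw : (x - b) * t ≤ -s * (2 - y)) : 2 * x - b * y ≤ 2 - y := by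
  by_contra hcon
  push Not at hcon
  rcases h with h | h
  · have h1 : t * (2 * x - b * y) ≤ 2 - y := by nlinarith
    nlinarith
  · obtain ⟨m, rfl⟩ := hb
    have ht2 : 2 ≤ t := by
      by_contra h2
      have : t = 1 := by omega
      subst this
      omega
    have h1 : t * (2 * x - (2 * m + 1) * y) ≤ 2 * (2 - y) := by nlinarith
    nlinarith

/-- The bound coming from the edge following `(b, 2)`. -/
lemma right_bound {S : Finset (ℤ × ℤ)} (hG : Good S) {b : ℤ} (hb : ∃ m, b = 2 * m + 1)
    (hbS : (b, 2) ∈ S) (htop : ∀ w ∈ S, w.2 ≤ 2) (hmax : ∀ w ∈ S, w.2 = 2 → w.1 ≤ b) :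
    ∀ w ∈ S, 2 * w.1 - b * w.2 ≤ 2 - w.2 := by
  have hne : (S.filter fun w => w.2 < 2).Nonempty := by
    obtain ⟨w, hw, hp⟩ := hG.pos 0 (-1) (by norm_num)
    exact ⟨w, Finset.mem_filter.2 ⟨hw, by linarith⟩⟩
  obtain ⟨v, hv, hvmax⟩ := Finset.exists_max_image _
    (fun w : ℤ × ℤ => ((w.1 - b : ℤ) : ℚ) / ((2 - w.2 : ℤ) : ℚ)) hne
  rw [Finset.mem_filter] at hv
  obtain ⟨hv, hv2⟩ := hv
  have key : ∀ w ∈ S, (w.1 - b) * (2 - v.2) ≤ (v.1 - b) * (2 - w.2) := by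
    intro w hw
    by_cases hw2 : w.2 = 2
    · have := hmax w hw hw2
      rw [hw2]
      nlinarith
    · have hw2' : w.2 < 2 := lt_of_le_of_ne (htop w hw) hw2
      have h1 := hvmax w (Finset.mem_filter.2 ⟨hw, hw2'⟩)
      have p1 : (0 : ℚ) < ((2 - w.2 : ℤ) : ℚ) := by exact_mod_cast (by linarith)
      have p2 : (0 : ℚ) < ((2 - v.2 : ℤ) : ℚ) := by exact_mod_cast (by linarith)
      rw [div_le_div_iff₀ p1 p2] at h1
      exact_mod_cast h1
  have hpos : 0 < det2 v (b, 2) := by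
    obtain ⟨w, hw, hp⟩ := hG.pos (2 - v.2) (v.1 - b) (Or.inl (by linarith))
    have := key w hw
    simp only [det2]
    linarith
  obtain ⟨k, s, t, e1, e2, e3⟩ := hG.edge v hv (b, 2) hbS hpos (by
    intro w hw
    have := key w hw
    simp only [det3]
    linarith)
  simp only at e1 e2
  have hk : 0 < k := by rcases e3 with h | h <;> linarith
  have ht : 0 < t := by
    have : 0 < k * t := by linarith
    exact pos_of_mul_pos_right this hk.le
  have hdet : det2 v (b, 2) = k * (b * t - 2 * s) := by
    simp only [det2]
    linear_combination b * e2 - 2 * e1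
  have hcase : b * t - 2 * s = 1 ∨ b * t - 2 * s = 2 := by
    rcases e3 with h | h
    · left; apply mul_left_cancel₀ hk.ne'; linarith
    · right; apply mul_left_cancel₀ hk.ne'; linarith
  intro w hw
  apply bound_aux hb ht hcase (htop w hw)
  have := key w hw
  rw [e2] at this
  have hv1 : v.1 - b = -(k * s) := by linarith
  rw [hv1] at this
  apply le_of_mul_le_mul_left _ hk
  linarith

/-- The bound coming from the edge preceding `(-1, 2)`. -/
lemma left_bound {S : Finset (ℤ × ℤ)} (hG : Good S)
    (haS : (-1, 2) ∈ S) (htop : ∀ w ∈ S, w.2 ≤ 2) (hmin : ∀ w ∈ S, w.2 = 2 → -1 ≤ w.1) :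
    ∀ w ∈ S, -1 ≤ w.1 := by
  have hne : (S.filter fun w => w.2 < 2).Nonempty := by
    obtain ⟨w, hw, hp⟩ := hG.pos 0 (-1) (by norm_num)
    exact ⟨w, Finset.mem_filter.2 ⟨hw, by linarith⟩⟩
  obtain ⟨v, hv, hvmax⟩ := Finset.exists_max_image _
    (fun w : ℤ × ℤ => ((-w.1 - 1 : ℤ) : ℚ) / ((2 - w.2 : ℤ) : ℚ)) hne
  rw [Finset.mem_filter] at hv
  obtain ⟨hv, hv2⟩ := hv
  have key : ∀ w ∈ S, (-w.1 - 1) * (2 - v.2) ≤ (-v.1 - 1) * (2 - w.2) := by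
    intro w hw
    by_cases hw2 : w.2 = 2
    · have := hmin w hw hw2
      rw [hw2]
      nlinarith
    · have hw2' : w.2 < 2 := lt_of_le_of_ne (htop w hw) hw2
      have h1 := hvmax w (Finset.mem_filter.2 ⟨hw, hw2'⟩)
      have p1 : (0 : ℚ) < ((2 - w.2 : ℤ) : ℚ) := by exact_mod_cast (by linarith)
      have p2 : (0 : ℚ) < ((2 - v.2 : ℤ) : ℚ) := by exact_mod_cast (by linarith)
      rw [div_le_div_iff₀ p1 p2] at h1
      exact_mod_cast h1
  have hpos : 0 < det2 (-1, 2) v := by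
    obtain ⟨w, hw, hp⟩ := hG.pos (-(2 - v.2)) (-v.1 - 1) (Or.inl (by linarith))
    have := key w hw
    simp only [det2]
    linarith
  obtain ⟨k, s, t, e1, e2, e3⟩ := hG.edge (-1, 2) haS v hv hpos (by
    intro w hw
    have := key w hw
    simp only [det3]
    linarith)
  simp only at e1 e2
  have hk : 0 < k := by rcases e3 with h | h <;> linarith
  have ht : 0 < -t := by
    have : 0 < k * -t := by linarith
    exact pos_of_mul_pos_right this hk.le
  have hdet : det2 (-1, 2) v = k * (1 * -t - 2 * s) := by
    simp only [det2]
    linear_combination -e2 - 2 * e1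
  have hcase : 1 * -t - 2 * s = 1 ∨ 1 * -t - 2 * s = 2 := by
    rcases e3 with h | h
    · left; apply mul_left_cancel₀ hk.ne'; linarith
    · right; apply mul_left_cancel₀ hk.ne'; linarith
  intro w hw
  have := bound_aux (x := -w.1) (y := w.2) ⟨0, by norm_num⟩ ht hcase (htop w hw) (by
    have := key w hw
    have e2' : 2 - v.2 = k * -t := by linarith
    have e1' : -v.1 - 1 = -(k * s) := by linarith
    rw [e2', e1'] at this
    apply le_of_mul_le_mul_left _ hk
    linarith)
  linarith

/-- Conclusion of the case analysis. -/
lemma finish {S : Finset (ℤ × ℤ)} (V : Finset (ℤ × ℤ)) (h1 : V ⊆ S) (h2 : ∀ p ∈ S, InTri V p)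
    (h3 : Cls V) : ∃ i, UnimodEquiv (hull S) (hull (rep i)) := by
  rw [hull_eq h1 fun p hp => (h2 p hp).mem]
  exact h3.unimod

/-- The case of a top edge of length six. -/
lemma case_five {S : Finset (ℤ × ℤ)} (hG : Good S) (h1 : (-1, 2) ∈ S) (h2 : (5, 2) ∈ S)
    (htop : ∀ w ∈ S, w.2 ≤ 2) (hl : ∀ w ∈ S, -1 ≤ w.1) (hr : ∀ w ∈ S, w.1 ≤ 1 + 2 * w.2) :
    ∃ i, UnimodEquiv (hull S) (hull (rep i)) := by
  have h3 : (-1, -1) ∈ S := by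
    obtain ⟨w, hw, hp⟩ := hG.pos 0 (-1) (by norm_num)
    have := hl w hw
    have := hr w hw
    have e : w = (-1, -1) := Prod.ext (by simp only; omega) (by simp only; omega)
    rwa [← e]
  refine finish {(-1, -1), (-1, 2), (5, 2)} ?_ ?_ (by decide +kernel)
  · intro p hp
    simp only [Finset.mem_insert, Finset.mem_singleton] at hp
    rcases hp with rfl | rfl | rfl <;> assumption
  · intro p hp
    have := hl p hp
    have := hr p hp
    have := htop p hp
    have key : ∀ x ∈ Finset.Icc (-1 : ℤ) 5, ∀ y ∈ Finset.Icc (-1 : ℤ) 2, x ≤ 1 + 2 * y →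
        InTri {(-1, -1), (-1, 2), (5, 2)} (x, y) := by decide +kernel
    exact key p.1 (Finset.mem_Icc.2 ⟨by omega, by omega⟩) p.2
      (Finset.mem_Icc.2 ⟨by omega, by omega⟩) (by omega)

/-- The case of a top edge of length four. -/
lemma case_three {S : Finset (ℤ × ℤ)} (hG : Good S) (h1 : (-1, 2) ∈ S) (h2 : (3, 2) ∈ S)
    (htop : ∀ w ∈ S, w.2 ≤ 2) (hl : ∀ w ∈ S, -1 ≤ w.1) (hr : ∀ w ∈ S, w.1 ≤ 1 + w.2) :
    ∃ i, UnimodEquiv (hull S) (hull (rep i)) := by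
  -- the points that may occur
  have box : ∀ p ∈ S, p.1 ∈ Finset.Icc (-1 : ℤ) 3 ∧ p.2 ∈ Finset.Icc (-2 : ℤ) 2 := by
    intro p hp
    have := hl p hp
    have := hr p hp
    have := htop p hp
    exact ⟨Finset.mem_Icc.2 ⟨by omega, by omega⟩, Finset.mem_Icc.2 ⟨by omega, by omega⟩⟩
  have go : ∀ (E V : Finset (ℤ × ℤ)), V ⊆ S → (∀ e ∈ E, e ∉ S) →
      (∀ x ∈ Finset.Icc (-1 : ℤ) 3, ∀ y ∈ Finset.Icc (-2 : ℤ) 2, x ≤ 1 + y → (x, y) ∉ E →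
        InTri V (x, y)) → Cls V → ∃ i, UnimodEquiv (hull S) (hull (rep i)) := by
    intro E V hV hE hin hc
    refine finish V hV (fun p hp => ?_) hc
    exact hin p.1 (box p hp).1 p.2 (box p hp).2 (hr p hp) (fun he => hE p he hp)
  by_cases c1 : (-1, -2) ∈ S
  · exact go ∅ {(-1, -2), (-1, 2), (3, 2)} (by simp [Finset.insert_subset_iff, *]) (by simp)
      (by decide +kernel) (by decide +kernel)
  by_cases c2 : (-1, -1) ∈ S
  · by_cases c3 : (0, -1) ∈ S
    · exact go {(-1, -2)} {(-1, -1), (0, -1), (3, 2), (-1, 2)}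
        (by simp [Finset.insert_subset_iff, *]) (by simp [*])
        (by decide +kernel) (by decide +kernel)
    by_cases c4 : (1, 0) ∈ S
    · exact go {(-1, -2), (0, -1)} {(-1, -1), (-1, 2), (3, 2), (1, 0)}
        (by simp [Finset.insert_subset_iff, *]) (by simp [*])
        (by decide +kernel) (by decide +kernel)
    by_cases c5 : (2, 1) ∈ S
    · exact go {(-1, -2), (0, -1), (1, 0)} {(-1, -1), (-1, 2), (3, 2), (2, 1)}
        (by simp [Finset.insert_subset_iff, *]) (by simp [*])
        (by decide +kernel) (by decide +kernel)
    · exact go {(-1, -2), (0, -1), (1, 0), (2, 1)} {(-1, -1), (-1, 2), (3, 2)}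
        (by simp [Finset.insert_subset_iff, *]) (by simp [*])
        (by decide +kernel) (by decide +kernel)
  · have c3 : (0, -1) ∈ S := by
      obtain ⟨w, hw, hp⟩ := hG.pos 0 (-1) (by norm_num)
      have b1 := hl w hw
      have b2 := hr w hw
      by_contra hcon
      have hy : w.2 = -1 ∨ w.2 = -2 := by omega
      have hx : w = (-1, -2) ∨ w = (-1, -1) ∨ w = (0, -1) := by
        simp only [Prod.ext_iff]
        omega
      rcases hx with rfl | rfl | rfl <;> contradiction
    by_cases c4 : (-1, 0) ∈ S
    · exact go {(-1, -2), (-1, -1)} {(0, -1), (-1, 2), (3, 2), (-1, 0)}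
        (by simp [Finset.insert_subset_iff, *]) (by simp [*])
        (by decide +kernel) (by decide +kernel)
    by_cases c5 : (-1, 1) ∈ S
    · exact go {(-1, -2), (-1, -1), (-1, 0)} {(0, -1), (-1, 2), (3, 2), (-1, 1)}
        (by simp [Finset.insert_subset_iff, *]) (by simp [*])
        (by decide +kernel) (by decide +kernel)
    · exact go {(-1, -2), (-1, -1), (-1, 0), (-1, 1)} {(0, -1), (-1, 2), (3, 2)}
        (by simp [Finset.insert_subset_iff, *]) (by simp [*])
        (by decide +kernel) (by decide +kernel)

lemma strip_f0 : ∀ r ∈ Finset.Icc (-6 : ℤ) 2, ∀ l ∈ Finset.Icc (-6 : ℤ) 2,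
    (r + l = -1 ∨ r + l = -2 ∨ r + l = -4) →
    (∀ y ∈ Finset.Icc r 2, InTri (f0 r l) (1, y)) ∧ (∀ y ∈ Finset.Icc l 2, InTri (f0 r l) (-1, y)) ∧
    InTri (f0 r l) (0, 1) ∧ (r + l ≤ -2 → InTri (f0 r l) (0, -1)) ∧ Cls (f0 r l) := by
  decide +kernel

lemma strip_f1 : ∀ r ∈ Finset.Icc (-3 : ℤ) 2, ∀ l ∈ Finset.Icc (-3 : ℤ) 2, -1 ≤ r + l →
    (∀ y ∈ Finset.Icc r 2, InTri (f1 r l) (1, y)) ∧ (∀ y ∈ Finset.Icc l 2, InTri (f1 r l) (-1, y)) ∧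
    InTri (f1 r l) (0, 1) ∧ InTri (f1 r l) (0, -1) ∧ Cls (f1 r l) := by
  decide +kernel

/-- The case of a top edge of length two. -/
lemma case_one {S : Finset (ℤ × ℤ)} (hG : Good S) (h1 : (-1, 2) ∈ S) (h2 : (1, 2) ∈ S)
    (htop : ∀ w ∈ S, w.2 ≤ 2) (hl : ∀ w ∈ S, -1 ≤ w.1) (hr : ∀ w ∈ S, w.1 ≤ 1) :
    ∃ i, UnimodEquiv (hull S) (hull (rep i)) := by
  obtain ⟨⟨pr1, r⟩, hr1, hrmin⟩ := Finset.exists_min_image (S.filter fun w => w.1 = 1)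
    (fun w => w.2) ⟨(1, 2), by simp [h2]⟩
  obtain ⟨⟨pl1, l⟩, hl1, hlmin⟩ := Finset.exists_min_image (S.filter fun w => w.1 = -1)
    (fun w => w.2) ⟨(-1, 2), by simp [h1]⟩
  simp only [Finset.mem_filter] at hr1 hl1 hrmin hlmin
  obtain ⟨hrS, rfl⟩ := hr1
  obtain ⟨hlS, rfl⟩ := hl1
  have hr2 : r ≤ 2 := htop _ hrS
  have hl2 : l ≤ 2 := htop _ hlS
  -- description of the points
  have desc : ∀ w ∈ S, (∃ y, w = (1, y) ∧ r ≤ y ∧ y ≤ 2) ∨ (∃ y, w = (-1, y) ∧ l ≤ y ∧ y ≤ 2) ∨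
      w = (0, 1) ∨ w = (0, -1) := by
    intro w hw
    have a1 := hl w hw
    have a2 := hr w hw
    have hx : w.1 = 1 ∨ w.1 = -1 ∨ w.1 = 0 := by omega
    rcases hx with hx | hx | hx
    · left
      exact ⟨w.2, Prod.ext hx rfl, hrmin w ⟨hw, hx⟩, htop w hw⟩
    · right; left
      exact ⟨w.2, Prod.ext hx rfl, hlmin w ⟨hw, hx⟩, htop w hw⟩
    · right; right
      have := hG.prim w hw
      rw [hx, Int.gcd_zero_left] at this
      rcases Int.natAbs_eq w.2 with h | h
      · left; exact Prod.ext hx (by rw [h, this]; rfl)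
      · right; exact Prod.ext hx (by rw [h, this]; rfl)
  by_cases hcase : (0, -1) ∈ S ∧ -1 ≤ r + l
  · obtain ⟨h0, hrl⟩ := hcase
    obtain ⟨t1, t2, t3, t4, t5⟩ := strip_f1 r (Finset.mem_Icc.2 ⟨by omega, hr2⟩) l
      (Finset.mem_Icc.2 ⟨by omega, hl2⟩) hrl
    refine finish (f1 r l) (by simp [f1, Finset.insert_subset_iff, *]) ?_ t5
    intro p hp
    rcases desc p hp with ⟨y, rfl, b1, b2⟩ | ⟨y, rfl, b1, b2⟩ | rfl | rfl
    · exact t1 y (Finset.mem_Icc.2 ⟨b1, b2⟩)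
    · exact t2 y (Finset.mem_Icc.2 ⟨b1, b2⟩)
    · exact t3
    · exact t4
  · have hcase' : (0, -1) ∈ S → r + l ≤ -2 := by
      intro h
      by_contra hcon
      exact hcase ⟨h, by omega⟩
    have hneg : r + l < 0 := by
      by_contra hcon
      obtain ⟨w, hw, hp⟩ := hG.pos (r - l) (-2) (by norm_num)
      rcases desc w hw with ⟨y, rfl, b1, b2⟩ | ⟨y, rfl, b1, b2⟩ | rfl | rfl
      · simp only at hp; omega
      · simp only at hp; omega
      · simp only at hp; omega
      · have := hcase' hw; omega
    obtain ⟨k, s, t, e1, e2, e3⟩ := hG.edge (-1, l) hlS (1, r) hrS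
      (by simp only [det2]; linarith) (by
        intro w hw
        simp only [det3]
        rcases desc w hw with ⟨y, rfl, b1, b2⟩ | ⟨y, rfl, b1, b2⟩ | rfl | rfl
        · simp only; linarith
        · simp only; linarith
        · simp only; linarith
        · have := hcase' hw
          simp only; linarith)
    simp only [det2] at e1 e2 e3
    have hk : 0 < k := by omega
    have hk2 : k ≤ 2 := Int.le_of_dvd (by norm_num) ⟨s, by linarith⟩
    have hsum : r + l = -1 ∨ r + l = -2 ∨ r + l = -4 := by
      have : k = 1 ∨ k = 2 := by omega
      rcases this with rfl | rfl <;> omega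
    obtain ⟨t1, t2, t3, t4, t5⟩ := strip_f0 r (Finset.mem_Icc.2 ⟨by omega, hr2⟩) l
      (Finset.mem_Icc.2 ⟨by omega, hl2⟩) hsum
    refine finish (f0 r l) (by simp [f0, Finset.insert_subset_iff, *]) ?_ t5
    intro p hp
    rcases desc p hp with ⟨y, rfl, b1, b2⟩ | ⟨y, rfl, b1, b2⟩ | rfl | rfl
    · exact t1 y (Finset.mem_Icc.2 ⟨b1, b2⟩)
    · exact t2 y (Finset.mem_Icc.2 ⟨b1, b2⟩)
    · exact t3
    · exact t4 (hcase' hp)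

/-- Classification in normalised coordinates. -/
lemma classify {S : Finset (ℤ × ℤ)} (hG : Good S) {b : ℤ} (hb : ∃ m, b = 2 * m + 1) (hb1 : -1 < b)
    (haS : (-1, 2) ∈ S) (hbS : (b, 2) ∈ S) (htop : ∀ w ∈ S, w.2 ≤ 2)
    (hrow : ∀ w ∈ S, w.2 = 2 → -1 ≤ w.1 ∧ w.1 ≤ b) :
    ∃ i, UnimodEquiv (hull S) (hull (rep i)) := by
  have hl := left_bound hG haS htop fun w hw h => (hrow w hw h).1
  have hr := right_bound hG hb hbS htop fun w hw h => (hrow w hw h).2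
  obtain ⟨m, rfl⟩ := hb
  have hr' : ∀ w ∈ S, w.1 ≤ 1 + m * w.2 := by
    intro w hw
    have := hr w hw
    linarith
  have hm0 : 0 ≤ m := by omega
  have hm2 : m ≤ 2 := by
    obtain ⟨w, hw, hp⟩ := hG.pos 0 (-1) (by norm_num)
    have := hr' w hw
    have := hl w hw
    nlinarith
  have : m = 0 ∨ m = 1 ∨ m = 2 := by omega
  rcases this with rfl | rfl | rfl
  · exact case_one hG haS hbS htop hl (fun w hw => by linarith [hr' w hw])
  · exact case_three hG haS hbS htop hl (fun w hw => by linarith [hr' w hw])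
  · exact case_five hG haS hbS htop hl (fun w hw => by linarith [hr' w hw])

/-- Bringing an edge of local index two into standard position. -/
lemma normalise {S : Finset (ℤ × ℤ)} (hG : Good S) {η : ℤ × ℤ} (hη : Int.gcd η.1 η.2 = 1)
    (htop : ∀ w ∈ S, η.1 * w.1 + η.2 * w.2 ≤ 2)
    (h2 : ∃ u ∈ S, ∃ v ∈ S, u ≠ v ∧ η.1 * u.1 + η.2 * u.2 = 2 ∧ η.1 * v.1 + η.2 * v.2 = 2) :
    ∃ i, UnimodEquiv (hull S) (hull (rep i)) := by
  obtain ⟨s, t, hst⟩ := Int.isCoprime_iff_gcd_eq_one.2 hη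
  obtain ⟨u, hu, v, hv, huv, hu2, hv2⟩ := h2
  obtain ⟨p, hp, hpmin⟩ := Finset.exists_min_image
    (S.filter fun w => η.1 * w.1 + η.2 * w.2 = 2) (fun w => t * w.1 - s * w.2)
    ⟨u, Finset.mem_filter.2 ⟨hu, hu2⟩⟩
  obtain ⟨q, hq, hqmax⟩ := Finset.exists_max_image
    (S.filter fun w => η.1 * w.1 + η.2 * w.2 = 2) (fun w => t * w.1 - s * w.2)
    ⟨u, Finset.mem_filter.2 ⟨hu, hu2⟩⟩
  rw [Finset.mem_filter] at hp hq
  have hne : t * u.1 - s * u.2 ≠ t * v.1 - s * v.2 := by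
    intro h
    apply huv
    have h' : η.1 * u.1 + η.2 * u.2 = η.1 * v.1 + η.2 * v.2 := hu2.trans hv2.symm
    ext
    · linear_combination η.2 * h + s * h' + (v.1 - u.1) * hst
    · linear_combination -η.1 * h + t * h' + (v.2 - u.2) * hst
  have hlt : t * p.1 - s * p.2 < t * q.1 - s * q.2 := by
    have a1 := hpmin u (Finset.mem_filter.2 ⟨hu, hu2⟩)
    have a2 := hpmin v (Finset.mem_filter.2 ⟨hv, hv2⟩)
    have a3 := hqmax u (Finset.mem_filter.2 ⟨hu, hu2⟩)
    have a4 := hqmax v (Finset.mem_filter.2 ⟨hv, hv2⟩)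
    omega
  -- parity
  have odd : ∀ w ∈ S, η.1 * w.1 + η.2 * w.2 = 2 → ∃ m, t * w.1 - s * w.2 = 2 * m + 1 := by
    intro w hw hw2
    rcases Int.even_or_odd' (t * w.1 - s * w.2) with ⟨m, hm | hm⟩
    · exfalso
      have g := hG.prim w hw
      have d1 : (2 : ℤ) ∣ w.1 :=
        ⟨η.2 * m + s, by linear_combination η.2 * hm + s * hw2 - w.1 * hst⟩
      have d2 : (2 : ℤ) ∣ w.2 :=
        ⟨-η.1 * m + t, by linear_combination -η.1 * hm + t * hw2 - w.2 * hst⟩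
      have := Int.dvd_coe_gcd d1 d2
      rw [g] at this
      norm_num at this
    · exact ⟨m, hm⟩
  obtain ⟨n, hn⟩ := odd p hp.1 hp.2
  obtain ⟨n', hn'⟩ := odd q hq.1 hq.2
  -- shear so that the left endpoint becomes `(-1, 2)`
  have hdet : (t - (n + 1) * η.1) * η.2 - (-s - (n + 1) * η.2) * η.1 = 1 := by
    linear_combination hst
  have hG' := hG.image hdet
  have happ : ∀ w, η.1 * w.1 + η.2 * w.2 = 2 →
      app (t - (n + 1) * η.1) (-s - (n + 1) * η.2) η.1 η.2 w
        = (t * w.1 - s * w.2 - 2 * (n + 1), 2) := by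
    intro w hw
    ext
    · simp only [app]
      linear_combination -(n + 1) * hw
    · simp only [app]; exact hw
  have ha' : ((-1, 2) : ℤ × ℤ) ∈ S.image (app (t - (n + 1) * η.1) (-s - (n + 1) * η.2) η.1 η.2) := by
    refine Finset.mem_image.2 ⟨p, hp.1, ?_⟩
    rw [happ p hp.2, hn]
    ext <;> simp only <;> ring
  have hb' : ((2 * (n' - n - 1) + 1, 2) : ℤ × ℤ) ∈
      S.image (app (t - (n + 1) * η.1) (-s - (n + 1) * η.2) η.1 η.2) := by
    refine Finset.mem_image.2 ⟨q, hq.1, ?_⟩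
    rw [happ q hq.2, hn']
    ext <;> simp only <;> ring
  obtain ⟨i, hi⟩ := classify hG' ⟨_, rfl⟩ (by omega) ha' hb'
    (by
      simp only [Finset.forall_mem_image]
      intro w hw
      exact htop w hw)
    (by
      simp only [Finset.forall_mem_image]
      intro w hw hw2
      have hw2' : η.1 * w.1 + η.2 * w.2 = 2 := hw2
      rw [happ w hw2']
      have a1 := hpmin w (Finset.mem_filter.2 ⟨hw, hw2'⟩)
      have a2 := hqmax w (Finset.mem_filter.2 ⟨hw, hw2'⟩)
      simp only
      constructor <;> linarith)
  exact ⟨i, unimod_trans (unimod_image S (Or.inl hdet)) hi⟩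

/-- There are precisely thirty LDP-polygons of index two, up to unimodular
equivalence. -/
theorem ldp_index_two_classification :
    ∃ R : Fin 30 → Set (ℚ × ℚ),
      (∀ i, IsLDPPolygon (R i) ∧ HasIndex (R i) 2) ∧
      (∀ i j, UnimodEquiv (R i) (R j) → i = j) ∧
      (∀ Q : Set (ℚ × ℚ), IsLDPPolygon Q → HasIndex Q 2 →
        ∃ i, UnimodEquiv Q (R i)) := by
  refine ⟨fun i => hull (rep i), fun i => ⟨(rep_ok i).ldp, (rep_ok i).index⟩, rep_inequiv, ?_⟩
  intro Q hL hI
  obtain ⟨S0, hS0⟩ := hL.1.1.1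
  obtain ⟨S, hS, hext⟩ := exists_extreme_set S0
  have hQ : Q = hull S := hS0.trans hS
  subst hQ
  have hG := good_of_ldp hext hL hI
  have hfacet : ∃ F η, IsFacetWith (hull S) η 2 F := by
    by_contra hcon
    push Not at hcon
    have := hI.2.2 1 (by norm_num) (by
      intro F η l hF
      have h1 := hI.2.1 F η l hF
      have h2 := Int.le_of_dvd (by norm_num) h1
      have h3 := hF.2.1
      have : l ≠ 2 := by
        rintro rfl
        exact hcon F η hF
      have : l = 1 := by omega
      rw [this])
    norm_num at this
  obtain ⟨F, η, hF⟩ := hfacet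
  obtain ⟨hle, hpts⟩ := facet_points hF
  exact normalise hG hF.1 hle hpts
end
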